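/- arXiv:2010.09096 — 3 statements merged into one kernel-verified Lean document; each statement's English description precedes it below -/
import Mathlib

section
/- Let X be a finite multiset of positive integers of size n = |X|, with maximum element mx(X), maximum multiplicity μ(X) and element sum Σ(X). Set C_δ := 1699200·log(2n)·log²(2μ(X)), C_α := 42480·log(2μ(X)) and C_λ := 169920·log(2μ(X)) (logarithms base 2). If X is C_δ-dense and has no C_α-almost divisor, then, setting λ := C_λ·μ(X)·mx(X)·Σ(X)/n², every integer t with λ ≤ t ≤ Σ(X) − λ is a subset sum of X, i.e. [λ, Σ(X)−λ] ∩ ℤ ⊆ S(X). -/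
open Multiset

/-- Maximum element of a multiset of naturals (0 if empty). -/
def mxElt (X : Multiset ℕ) : ℕ := X.sup

/-- Maximum multiplicity of a multiset of naturals. -/
def maxMul (X : Multiset ℕ) : ℕ := X.toFinset.sup fun x => X.count x

/-- The set of all subset sums of a multiset. -/
def subsetSums (X : Multiset ℕ) : Set ℕ := {s | ∃ Y ≤ X, Y.sum = s}

/-- `X` is `δ`-dense if `|X|² ≥ δ·μ(X)·mx(X)`. -/
def DenseMS (δ : ℝ) (X : Multiset ℕ) : Prop :=
  δ * maxMul X * mxElt X ≤ (Multiset.card X : ℝ) ^ 2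

/-- `d > 1` is an `α`-almost divisor of `X` if the number of elements of `X` not
divisible by `d` is at most `α·μ(X)·Σ(X)/|X|²`. -/
def AlmostDivisor (α : ℝ) (X : Multiset ℕ) (d : ℕ) : Prop :=
  1 < d ∧ ((Multiset.card (X.filter fun x => ¬ d ∣ x) : ℝ) ≤
    α * maxMul X * X.sum / (Multiset.card X : ℝ) ^ 2)

/-- A multiset is uniform if every element has the maximum multiplicity. -/
def IsUniformMS (X : Multiset ℕ) : Prop := ∀ x ∈ X, X.count x = maxMul X

/-- Number of representations `f_X(z) = μ(X) · #{(x,x') ∈ supp(X)² : x + x' = z}`. -/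
def fX (X : Multiset ℕ) (z : ℕ) : ℕ :=
  maxMul X * ((X.toFinset ×ˢ X.toFinset).filter fun p => p.1 + p.2 = z).card

/-- The bucket `B_{v,X} = {z : f_X(z) ≥ v}`. -/
def bucket (X : Multiset ℕ) (v : ℕ) : Set ℕ := {z | v ≤ fX X z}

open scoped Pointwise in
/-- Expansion of sumsets with a generating set containing `0`, by submodularity of
`S ↦ 2|G||S + B| - (2|G| - |B|)|S|`. -/
theorem card_mul_card_le_expansion {G : Type*} [AddCommGroup G] [Fintype G] [DecidableEq G]
    (B : Finset G) (h0 : (0 : G) ∈ B)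
    (hB : ∀ K : AddSubgroup G, (∀ x ∈ B, x ∈ K) → K = ⊤) (S : Finset G) (hS : S.Nonempty) :
    (Fintype.card G * B.card : ℤ) ≤
      2 * Fintype.card G * (S + B).card - (2 * Fintype.card G - B.card) * S.card := by
  obtain ⟨q, hq⟩ : ∃ q : ℤ, q = (Fintype.card G : ℤ) := ⟨_, rfl⟩
  rw [← hq]
  have hq0 : 0 ≤ q := by rw [hq]; positivity
  set e : Finset G → ℤ := fun S => 2 * q * (S + B).card - (2 * q - B.card) * S.card with he
  change q * B.card ≤ e S
  have esub (S T : Finset G) : e (S ∩ T) + e (S ∪ T) ≤ e S + e T := by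
    have h1 : (S ∪ T).card + (S ∩ T).card = S.card + T.card := Finset.card_union_add_card_inter S T
    have h2 : ((S ∪ T) + B).card + ((S ∩ T) + B).card ≤ (S + B).card + (T + B).card := by
      rw [Finset.union_add, ← Finset.card_union_add_card_inter (S + B)]
      have := Finset.card_le_card (Finset.inter_add_subset (s₁ := S) (s₂ := T) (t := B))
      omega
    zify at h1 h2
    simp only [he]
    nlinarith [mul_le_mul_of_nonneg_left h2 hq0]
  have etr (g : G) (S : Finset G) : e ({g} + S) = e S := by
    simp only [he, add_assoc, Finset.card_singleton_add]
  obtain ⟨H₁, hH₁, hmin₁⟩ := Finset.exists_min_image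
    (Finset.univ.filter fun T : Finset G => T.Nonempty) e ⟨S, by simpa using hS⟩
  obtain ⟨H, hH, hmin⟩ := Finset.exists_min_image
    (Finset.univ.filter fun T : Finset G => T.Nonempty ∧ e T = e H₁) Finset.card
    ⟨H₁, by simpa using hH₁⟩
  simp only [Finset.mem_filter, Finset.mem_univ, true_and] at hH₁ hmin₁ hH hmin
  obtain ⟨hHne, heH⟩ := hH
  refine le_trans ?_ (hmin₁ S hS)
  rw [← heH]
  rw [← heH] at hmin₁ hmin
  have hshift : ∀ g : G, (({g} + H) ∩ H).Nonempty → H ⊆ {g} + H := by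
    intro g hg
    have h1 := esub ({g} + H) H
    rw [etr] at h1
    have h2 := hmin₁ _ hg
    have h3 := hmin₁ (({g} + H) ∪ H) (hHne.mono Finset.subset_union_right)
    have h4 := hmin _ ⟨hg, by linarith⟩
    have h5 := Finset.eq_of_subset_of_card_le Finset.inter_subset_right h4
    exact Finset.inter_eq_right.1 h5
  by_cases hsmall : ∃ x ∈ H + B, x ∉ H
  · obtain ⟨x, hx, hxH⟩ := hsmall
    obtain ⟨y, hy, b, hb, rfl⟩ := Finset.mem_add.1 hx
    have hdisj : Disjoint ({b} + H) H := by
      rw [Finset.disjoint_iff_inter_eq_empty]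
      by_contra hne
      have hsub := hshift b (Finset.nonempty_iff_ne_empty.2 hne)
      have heq := Finset.eq_of_subset_of_card_le hsub (by simp)
      apply hxH
      rw [heq, add_comm y b]
      exact Finset.add_mem_add (Finset.mem_singleton_self b) hy
    have h1 : 2 * H.card ≤ (H + B).card := by
      calc 2 * H.card = (({b} + H) ∪ H).card := by
            rw [Finset.card_union_of_disjoint hdisj, Finset.card_singleton_add]; ring
        _ ≤ _ := by
            apply Finset.card_le_card
            apply Finset.union_subset
            · rw [add_comm]
              exact Finset.add_subset_add_left (Finset.singleton_subset_iff.2 hb)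
            · exact Finset.subset_add_left _ h0
    have h2 : B.card ≤ (H + B).card := Finset.card_le_card_add_left hHne
    zify at h1 h2
    have hb0 : (0 : ℤ) ≤ B.card := by positivity
    have hH0 : (0 : ℤ) ≤ H.card := by positivity
    simp only [he]
    nlinarith [mul_le_mul_of_nonneg_left h1 hq0, mul_le_mul_of_nonneg_left h2 hq0,
      mul_nonneg hb0 hH0]
  · push Not at hsmall
    have hHu : H = Finset.univ := by
      obtain ⟨y, hy⟩ := hHne
      have hK := hB (AddAction.stabilizer G H) (by
        intro b hb
        rw [AddAction.mem_stabilizer_iff]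
        apply Finset.eq_of_subset_of_card_le _ (by simp)
        intro z hz
        obtain ⟨w, hw, rfl⟩ := Finset.mem_vadd_finset.1 hz
        rw [vadd_eq_add, add_comm]
        exact hsmall _ (Finset.add_mem_add hw hb))
      ext z
      simp only [Finset.mem_univ, iff_true]
      have hz : z - y ∈ AddAction.stabilizer G H := by rw [hK]; trivial
      rw [AddAction.mem_stabilizer_iff] at hz
      rw [← hz, Finset.mem_vadd_finset]
      exact ⟨y, hy, by simp⟩
    have h1 : (H + B).card = Fintype.card G := by
      rw [← Finset.card_univ]
      congr 1
      exact Finset.univ_subset_iff.1 (hHu ▸ Finset.subset_add_left _ h0)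
    have h2 : H.card = Fintype.card G := by rw [hHu, Finset.card_univ]
    simp only [he, h1, h2, ← hq]
    apply le_of_eq; ring

open scoped Pointwise in
theorem nsmul_eq_univ_of_generating {G : Type*} [AddCommGroup G] [Fintype G] [DecidableEq G]
    (B : Finset G) (h0 : (0 : G) ∈ B)
    (hB : ∀ K : AddSubgroup G, (∀ x ∈ B, x ∈ K) → K = ⊤) (i : ℕ)
    (hi : 2 * Fintype.card G ≤ i * B.card) :
    (i + i) • B = Finset.univ := by
  have key : ∀ i : ℕ, Fintype.card G < 2 * (i • B).card ∨ 4 + i * B.card ≤ 4 * (i • B).card := by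
    intro i
    induction i with
    | zero => right; simp
    | succ i ih =>
      by_cases hc : Fintype.card G < 2 * (i • B).card
      · left
        refine hc.trans_le ?_
        rw [succ_nsmul]
        gcongr
        exact Finset.subset_add_left _ h0
      · right
        have ih := ih.resolve_left hc
        have hne : (i • B).Nonempty := by
          rw [← Finset.card_pos]; omega
        have h1 := card_mul_card_le_expansion B h0 hB (i • B) hne
        rw [succ_nsmul]
        push Not at hc
        have hq : 0 < Fintype.card G := Fintype.card_pos_iff.2 ⟨0⟩
        zify at *
        have : (4 * Fintype.card G : ℤ) * (i • B).card + Fintype.card G * B.card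
            ≤ 4 * Fintype.card G * (i • B + B).card := by
          nlinarith
        have h2 : (Fintype.card G : ℤ) * (4 * (i • B).card + B.card) ≤
          Fintype.card G * (4 * (i • B + B).card) := by linarith
        have h3 := le_of_mul_le_mul_left h2 hq
        linarith
  have hbig : Fintype.card G < 2 * (i • B).card := by
    rcases key i with h | h
    · exact h
    · omega
  rw [add_nsmul]
  ext z
  simp only [Finset.mem_univ, iff_true]
  have h1 : ((i • B) ∩ ((i • B).image fun x => z - x)).Nonempty := by
    by_contra hne
    rw [Finset.not_nonempty_iff_eq_empty, ← Finset.disjoint_iff_inter_eq_empty] at hne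
    have h2 := Finset.card_le_univ ((i • B) ∪ ((i • B).image fun x => z - x))
    rw [Finset.card_union_of_disjoint hne,
      Finset.card_image_of_injective _ (fun a b h => by simpa using h)] at h2
    omega
  obtain ⟨x, hx⟩ := h1
  simp only [Finset.mem_inter, Finset.mem_image] at hx
  obtain ⟨hx, y, hy, rfl⟩ := hx
  exact Finset.mem_add.2 ⟨_, hx, y, hy, by simp⟩

open scoped Pointwise in
theorem exists_multiset_of_mem_nsmul_insert_image {G : Type*} [AddCommMonoid G] [DecidableEq G]
    (B : Finset ℕ) (f : ℕ → G) (i : ℕ) :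
    ∀ x ∈ i • (insert 0 (B.image f)),
      ∃ Z : Multiset ℕ, (∀ z ∈ Z, z ∈ B) ∧ Multiset.card Z ≤ i ∧ (Z.map f).sum = x := by
  induction i with
  | zero =>
    intro x hx
    rw [zero_nsmul, Finset.mem_zero] at hx
    exact ⟨0, by simp, by simp, by simp [hx]⟩
  | succ i ih =>
    intro x hx
    rw [succ_nsmul] at hx
    obtain ⟨y, hy, c, hc, rfl⟩ := Finset.mem_add.1 hx
    obtain ⟨Z, hZ, hcard, rfl⟩ := ih y hy
    rcases Finset.mem_insert.1 hc with rfl | hc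
    · exact ⟨Z, hZ, by omega, by simp⟩
    · obtain ⟨b, hb, rfl⟩ := Finset.mem_image.1 hc
      refine ⟨b ::ₘ Z, ?_, by simpa using hcard, by simp [add_comm]⟩
      intro z hz
      rcases Multiset.mem_cons.1 hz with rfl | hz
      exacts [hb, hZ z hz]

theorem ZMod.addSubgroup_eq_top_of_gcd_eq_one {ι : Type*} (q : ℕ) (B : Finset ι) (f : ι → ℕ)
    (hgcd : B.gcd f = 1) (K : AddSubgroup (ZMod q)) (hK : ∀ b ∈ B, (f b : ZMod q) ∈ K) :
    K = ⊤ := by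
  obtain ⟨a, ha⟩ := Int.subgroup_cyclic (K.comap (Int.castAddHom (ZMod q)))
  have hmem : ∀ x : ℤ, (x : ZMod q) ∈ K ↔ a ∣ x := by
    intro x
    rw [← Int.mem_zmultiples_iff, AddSubgroup.zmultiples_eq_closure, ← ha]
    simp
  have h1 : a.natAbs ∣ 1 := by
    rw [← hgcd]
    apply Finset.dvd_gcd
    intro b hb
    have := (hmem (f b)).1 (by simpa using hK b hb)
    exact Int.natAbs_dvd_natAbs.2 this
  rw [eq_top_iff]
  intro x _
  obtain ⟨y, rfl⟩ := ZMod.intCast_surjective x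
  rw [hmem]
  exact (Int.natAbs_dvd_natAbs.1 (by simpa using h1 : a.natAbs ∣ (1 : ℤ).natAbs)).trans (one_dvd y)

/-- A set `B` of positive integers with maximum `d * q`, where `d = gcd B`, represents every multiple
`d * y` in a long range as a sum of few elements of `B`, repetition allowed. -/
theorem exists_multiset_sum_eq_mul (B : Finset ℕ) (hne : B.Nonempty) (hpos : ∀ x ∈ B, 0 < x) :
    ∃ d q : ℕ, 0 < d ∧ B.card ≤ q ∧ d * q ∈ B ∧
      ∀ i w y : ℕ, 2 * q ≤ i * B.card → (i + i) * q ≤ y → y ≤ (i + i + w) * q →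
        ∃ Z : Multiset ℕ, (∀ z ∈ Z, z ∈ B) ∧ Multiset.card Z ≤ 2 * (i + i) + w ∧
          Z.sum = d * y := by
  set Q := B.max' hne with hQ
  have hQB : Q ∈ B := B.max'_mem hne
  set d := B.gcd id with hd
  have hdvd : ∀ b ∈ B, d ∣ b := fun b hb => Finset.gcd_dvd (f := id) hb
  have hd0 : 0 < d := Nat.pos_of_dvd_of_pos (hdvd Q hQB) (hpos Q hQB)
  have hgcd : B.gcd (fun b => b / d) = 1 := by
    have := Finset.gcd_div_id_eq_one hQB (hpos Q hQB).ne'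
    simpa using this
  set q := Q / d with hq
  have hdq : d * q = Q := Nat.mul_div_cancel' (hdvd Q hQB)
  have hq0 : 0 < q := Nat.div_pos (Nat.le_of_dvd (hpos Q hQB) (hdvd Q hQB)) hd0
  have : NeZero q := ⟨hq0.ne'⟩
  have hrange : ∀ b ∈ B, 0 < b / d ∧ b / d ≤ q := fun b hb =>
    ⟨Nat.div_pos (Nat.le_of_dvd (hpos b hb) (hdvd b hb)) hd0,
      Nat.div_le_div_right (B.le_max' b hb)⟩
  let f : ℕ → ZMod q := fun b => ((b / d : ℕ) : ZMod q)
  have hinj : Set.InjOn f B := by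
    intro a ha b hb hab
    have h1 := hrange a ha
    have h2 := hrange b hb
    have h3 : a / d ≡ b / d [MOD q] := (ZMod.natCast_eq_natCast_iff _ _ _).1 hab
    have h5 : a / d = b / d := by
      rcases le_total (a / d) (b / d) with h | h
      · by_contra hne
        have := (Nat.modEq_iff_dvd' h).1 h3
        have := Nat.le_of_dvd (by omega) this
        omega
      · by_contra hne
        have := (Nat.modEq_iff_dvd' h).1 h3.symm
        have := Nat.le_of_dvd (by omega) this
        omega
    rw [← Nat.mul_div_cancel' (hdvd a ha), h5, Nat.mul_div_cancel' (hdvd b hb)]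
  have hcard : (B.image f).card = B.card := Finset.card_image_of_injOn hinj
  refine ⟨d, q, hd0, ?_, hdq ▸ hQB, ?_⟩
  · rw [← hcard]
    simpa [ZMod.card] using Finset.card_le_univ (B.image f)
  · intro i w y hi hy1 hy2
    have huniv := nsmul_eq_univ_of_generating (insert 0 (B.image f)) (Finset.mem_insert_self _ _)
      (fun K hK => ZMod.addSubgroup_eq_top_of_gcd_eq_one q B _ hgcd K fun b hb =>
        hK _ (Finset.mem_insert_of_mem (Finset.mem_image_of_mem f hb))) i (by
        rw [ZMod.card]
        refine hi.trans ?_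
        gcongr
        rw [← hcard]
        exact Finset.card_le_card (Finset.subset_insert _ _))
    obtain ⟨Z, hZ, hZc, hZs⟩ := exists_multiset_of_mem_nsmul_insert_image B f (i + i) (y : ZMod q)
      (huniv ▸ Finset.mem_univ _)
    set s := (Z.map fun b => b / d).sum with hs
    have hZsum : Z.sum = d * s := by
      rw [hs, ← Multiset.sum_map_mul_left, Multiset.map_congr rfl
        (fun z hz => Nat.mul_div_cancel' (hdvd z (hZ z hz))), Multiset.map_id']
    have hsy : s ≡ y [MOD q] := by
      rw [← ZMod.natCast_eq_natCast_iff, ← hZs, hs, Nat.cast_multiset_sum, Multiset.map_map]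
      rfl
    have hsle : s ≤ (i + i) * q := by
      refine (Multiset.sum_le_card_nsmul _ q ?_).trans ?_
      · intro x hx
        obtain ⟨z, hz, rfl⟩ := Multiset.mem_map.1 hx
        exact (hrange z (hZ z hz)).2
      · rw [Multiset.card_map, smul_eq_mul]
        gcongr
    obtain ⟨c, hc⟩ := (Nat.modEq_iff_dvd' (hsle.trans hy1)).1 hsy
    have hcle : c ≤ i + i + w := by
      have : q * c ≤ q * (i + i + w) := by
        rw [← hc, mul_comm q]; omega
      exact Nat.le_of_mul_le_mul_left this hq0
    refine ⟨Z + Multiset.replicate c Q, ?_, ?_, ?_⟩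
    · intro z hz
      rcases Multiset.mem_add.1 hz with hz | hz
      · exact hZ z hz
      · rw [Multiset.eq_of_mem_replicate hz]; exact hQB
    · rw [Multiset.card_add, Multiset.card_replicate]; omega
    · rw [Multiset.sum_add, Multiset.sum_replicate, hZsum, smul_eq_mul, ← hdq]
      have : y = s + q * c := by omega
      rw [this]; ring

theorem exists_le_nsmul_val_sum_eq (D : Finset ℕ) (r u : ℕ) (hr : 0 < r) (Z : Multiset ℕ)
    (hZ : ∀ z ∈ Z, u ≤ ((D ×ˢ D).filter fun p => p.1 + p.2 = z).card)
    (hc : 8 * Multiset.card Z ≤ r * u) :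
    ∃ U ≤ r • D.val, Multiset.card U = 2 * Multiset.card Z ∧ U.sum = Z.sum := by
  induction Z using Multiset.induction_on with
  | empty => exact ⟨0, Multiset.zero_le _, by simp, by simp⟩
  | cons z Z ih =>
    rw [Multiset.card_cons] at hc
    obtain ⟨U, hU, hUc, hUs⟩ := ih (fun y hy => hZ y (Multiset.mem_cons_of_mem hy)) (by omega)
    have hz := hZ z (Multiset.mem_cons_self z Z)
    set P := (D ×ˢ D).filter fun p => p.1 + p.2 = z with hP
    set S := D.filter fun x => r ≤ 2 * U.count x with hS
    have hcountD : ∀ x, (r • D.val).count x = if x ∈ D then r else 0 := by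
      intro x
      rw [Multiset.count_nsmul, Multiset.count_eq_of_nodup D.nodup]
      simp
    have hUle : ∀ x, U.count x ≤ if x ∈ D then r else 0 := fun x =>
      (hcountD x) ▸ Multiset.le_iff_count.1 hU x
    have hScard : r * S.card ≤ 4 * Multiset.card Z := by
      calc r * S.card = ∑ x ∈ S, r := by rw [Finset.sum_const, smul_eq_mul, mul_comm]
        _ ≤ ∑ x ∈ S, 2 * U.count x :=
          Finset.sum_le_sum fun x hx => (Finset.mem_filter.1 hx).2
        _ = 2 * ∑ x ∈ S, U.count x := by rw [Finset.mul_sum]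
        _ ≤ 2 * Multiset.card U := by
          gcongr
          calc ∑ x ∈ S, U.count x ≤ ∑ x ∈ D, U.count x :=
                Finset.sum_le_sum_of_subset (Finset.filter_subset _ _)
            _ = Multiset.card U := Multiset.sum_count_eq_card fun x hx => by
                have := hUle x
                have h2 := Multiset.one_le_count_iff_mem.2 hx
                by_contra hxD
                rw [if_neg hxD] at this
                omega
        _ = 4 * Multiset.card Z := by rw [hUc]; ring
    have hgood : ∃ p ∈ P, p.1 ∉ S ∧ p.2 ∉ S ∧ ¬ (p.1 = p.2 ∧ r = 1) := by
      by_contra! hbad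
      have hsub : P ⊆ P.filter (fun p => p.1 ∈ S) ∪ P.filter (fun p => p.2 ∈ S) ∪
          P.filter (fun p => p.1 = p.2 ∧ r = 1) := by
        intro p hp
        have := hbad p hp
        simp only [Finset.mem_union, Finset.mem_filter, hp, true_and]
        tauto
      have h1 : (P.filter fun p => p.1 ∈ S).card ≤ S.card := by
        apply Finset.card_le_card_of_injOn (fun p => p.1)
        · intro p hp
          exact (Finset.mem_filter.1 hp).2
        · intro p hp p' hp' h
          have h1 := (Finset.mem_filter.1 (Finset.mem_filter.1 hp).1).2
          have h2 := (Finset.mem_filter.1 (Finset.mem_filter.1 hp').1).2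
          ext <;> simp only at h ⊢ <;> omega
      have h2 : (P.filter fun p => p.2 ∈ S).card ≤ S.card := by
        apply Finset.card_le_card_of_injOn (fun p => p.2)
        · intro p hp
          exact (Finset.mem_filter.1 hp).2
        · intro p hp p' hp' h
          have h1 := (Finset.mem_filter.1 (Finset.mem_filter.1 hp).1).2
          have h2 := (Finset.mem_filter.1 (Finset.mem_filter.1 hp').1).2
          ext <;> simp only at h ⊢ <;> omega
      have h3 : r * (P.filter fun p => p.1 = p.2 ∧ r = 1).card ≤ 1 := by
        by_cases hr1 : r = 1
        · rw [hr1, one_mul, Finset.card_le_one]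
          intro p hp p' hp'
          have h1 := Finset.mem_filter.1 hp
          have h2 := Finset.mem_filter.1 hp'
          have h3 := (Finset.mem_filter.1 h1.1).2
          have h4 := (Finset.mem_filter.1 h2.1).2
          have h5 := h1.2.1
          have h6 := h2.2.1
          ext <;> omega
        · simp [hr1]
      have h4 := (Finset.card_le_card hsub).trans
        ((Finset.card_union_le _ _).trans (Nat.add_le_add_right (Finset.card_union_le _ _) _))
      have h5 := Nat.mul_le_mul_left r (hz.trans h4)
      nlinarith [Nat.mul_le_mul_left r h1, Nat.mul_le_mul_left r h2]
    obtain ⟨p, hp, hp1, hp2, hp3⟩ := hgood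
    obtain ⟨hpD, hpz⟩ := Finset.mem_filter.1 hp
    obtain ⟨hD1, hD2⟩ := Finset.mem_product.1 hpD
    have hp1' : 2 * U.count p.1 < r := by
      by_contra h; exact hp1 (Finset.mem_filter.2 ⟨hD1, by omega⟩)
    have hp2' : 2 * U.count p.2 < r := by
      by_contra h; exact hp2 (Finset.mem_filter.2 ⟨hD2, by omega⟩)
    refine ⟨p.1 ::ₘ p.2 ::ₘ U, ?_, ?_, ?_⟩
    · rw [Multiset.le_iff_count]
      intro x
      rw [hcountD, Multiset.count_cons, Multiset.count_cons]
      have := hUle x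
      by_cases hx1 : x = p.1
      · subst hx1
        rw [if_pos hD1] at this ⊢
        by_cases hx2 : p.1 = p.2
        · have : r ≠ 1 := fun h => hp3 ⟨hx2, h⟩
          simp only [hx2, if_true] at hp1' ⊢
          omega
        · simp only [hx2, if_true, if_false]
          omega
      · by_cases hx2 : x = p.2
        · subst hx2
          rw [if_pos hD2] at this ⊢
          simp only [hx1, if_true, if_false]
          omega
        · simpa [hx1, hx2] using this
    · simp only [Multiset.card_cons, hUc]; ring
    · simp only [Multiset.sum_cons, hUs, ← hpz]; ring

/-- For some `u`, many sums of two elements of `D` have at least `u` representations. -/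
theorem exists_popular_sums (D : Finset ℕ) (hD : D.Nonempty) (c : ℝ) (hc0 : 0 ≤ c)
    (hc : 2 * c * Real.logb 2 (2 * D.card) ≤ (D.card : ℝ) ^ 2) :
    ∃ u : ℕ, 0 < u ∧ (D.card : ℝ) / 2 + c / u ≤
      (((D ×ˢ D).image fun p => p.1 + p.2).filter fun z =>
        u ≤ ((D ×ˢ D).filter fun p => p.1 + p.2 = z).card).card := by
  set k := D.card with hk
  have hk0 : 0 < k := Finset.card_pos.2 hD
  set I := (D ×ˢ D).image fun p => p.1 + p.2 with hI
  set ρ : ℕ → ℕ := fun z => ((D ×ˢ D).filter fun p => p.1 + p.2 = z).card with hρ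
  by_contra! hcon
  have hρk : ∀ z, ρ z ≤ k := by
    intro z
    apply Finset.card_le_card_of_injOn (fun p => p.1)
    · intro p hp
      exact (Finset.mem_product.1 (Finset.mem_filter.1 hp).1).1
    · intro p hp p' hp' h
      have h1 := (Finset.mem_filter.1 hp).2
      have h2 := (Finset.mem_filter.1 hp').2
      ext <;> simp only at h ⊢ <;> omega
  have hlayer : k ^ 2 = ∑ i ∈ Finset.range k, (I.filter fun z => i + 1 ≤ ρ z).card := by
    have h1 : k ^ 2 = ∑ z ∈ I, ρ z := by
      rw [sq, hk, ← Finset.card_product]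
      exact Finset.card_eq_sum_card_fiberwise fun p hp => Finset.mem_image_of_mem _ hp
    rw [h1]
    simp_rw [Finset.card_filter]
    rw [Finset.sum_comm]
    refine Finset.sum_congr rfl fun z _ => ?_
    rw [← Finset.card_filter]
    have : (Finset.range k).filter (fun i => i + 1 ≤ ρ z) = Finset.range (ρ z) := by
      ext i
      have := hρk z
      simp only [Finset.mem_filter, Finset.mem_range]
      omega
    rw [this, Finset.card_range]
  have hlt : (k : ℝ) ^ 2 < ∑ i ∈ Finset.range k, ((k : ℝ) / 2 + c / ((i + 1 : ℕ) : ℝ)) := by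
    calc (k : ℝ) ^ 2 = ((∑ i ∈ Finset.range k, (I.filter fun z => i + 1 ≤ ρ z).card : ℕ) : ℝ) := by
          rw [← hlayer]; push_cast; rfl
      _ < _ := by
          rw [Nat.cast_sum]
          exact Finset.sum_lt_sum_of_nonempty (by simpa using hk0.ne')
            fun i _ => hcon (i + 1) (Nat.succ_pos i)
  have hsum : ∑ i ∈ Finset.range k, ((k : ℝ) / 2 + c / ((i + 1 : ℕ) : ℝ)) =
      (k : ℝ) ^ 2 / 2 + c * (harmonic k : ℝ) := by
    rw [Finset.sum_add_distrib, Finset.sum_const, Finset.card_range, nsmul_eq_mul, harmonic,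
      Rat.cast_sum, Finset.mul_sum]
    congr 1
    · ring
    · refine Finset.sum_congr rfl fun i _ => ?_
      push_cast
      rw [div_eq_mul_inv]
  have hharm : (harmonic k : ℝ) ≤ Real.logb 2 (2 * k) := by
    refine (harmonic_le_one_add_log k).trans ?_
    have hk1 : (1 : ℝ) ≤ k := by exact_mod_cast hk0
    rw [Real.logb_mul (by norm_num) (by positivity), Real.logb_self_eq_one (by norm_num),
      Real.logb]
    gcongr
    rw [le_div_iff₀ (Real.log_pos (by norm_num))]
    have := Real.log_two_lt_d9
    nlinarith [Real.log_nonneg hk1]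
  rw [hsum] at hlt
  nlinarith [mul_le_mul_of_nonneg_left hharm hc0]

/-- The subset sums of a dense uniform multiset `r • D.val` contain an arithmetic progression of
length `m + 1` whose common difference `d` divides all its terms. -/
theorem exists_homogeneous_progression (D : Finset ℕ) (hD : D.Nonempty) (hpos : ∀ x ∈ D, 0 < x)
    (r m M : ℕ) (hr : 0 < r) (hm : ∀ x ∈ D, x ≤ m) (hM : ∀ x ∈ D, x ≤ M)
    (hdense : 432 * m * Real.logb 2 (2 * D.card) ≤ r * (D.card : ℝ) ^ 2) :
    ∃ d y₀ : ℕ, 0 < d ∧ d * D.card ≤ 4 * M ∧ D.card * (d * y₀) ≤ 48 * (m * M) ∧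
      ∀ y, y₀ ≤ y → y ≤ y₀ + m → ∃ U ≤ r • D.val, U.sum = d * y := by
  have hr' : (0 : ℝ) < r := by exact_mod_cast hr
  have hk0 : 0 < D.card := Finset.card_pos.2 hD
  obtain ⟨x₀, hx₀⟩ := hD
  have hm0 : 0 < m := (hpos x₀ hx₀).trans_le (hm x₀ hx₀)
  obtain ⟨u, hu, hB⟩ := exists_popular_sums D ⟨x₀, hx₀⟩ (216 * m / r) (by positivity) (by
    rw [← mul_le_mul_iff_right₀ hr']
    refine le_trans (le_of_eq ?_) hdense
    field_simp
    ring)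
  have hu' : (0 : ℝ) < u := by exact_mod_cast hu
  set B := ((D ×ˢ D).image fun p => p.1 + p.2).filter fun z =>
    u ≤ ((D ×ˢ D).filter fun p => p.1 + p.2 = z).card with hBdef
  set b := B.card with hb
  have hmem : ∀ z ∈ B, 0 < z ∧ z ≤ 2 * m ∧ z ≤ 2 * M := by
    intro z hz
    obtain ⟨p, hp, rfl⟩ := Finset.mem_image.1 (Finset.mem_filter.1 hz).1
    obtain ⟨h1, h2⟩ := Finset.mem_product.1 hp
    have := hpos _ h1
    have := hm _ h1
    have := hM _ h1
    have := hm _ h2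
    have := hM _ h2
    omega
  have hkb : D.card ≤ 2 * b := by
    have : (0 : ℝ) ≤ 216 * m / r / u := by positivity
    have : (D.card : ℝ) ≤ 2 * b := by linarith
    exact_mod_cast this
  have hub : 216 * m ≤ b * (r * u) := by
    have h1 : 216 * m / r / u ≤ (b : ℝ) := by
      have : (0 : ℝ) ≤ D.card / 2 := by positivity
      linarith
    rw [div_div, div_le_iff₀ (by positivity)] at h1
    exact_mod_cast h1
  have hb0 : 0 < b := by omega
  obtain ⟨d, q, hd, hbq, hdq, hAP⟩ := exists_multiset_sum_eq_mul B (Finset.card_pos.1 hb0)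
    fun z hz => (hmem z hz).1
  obtain ⟨_, hdqm, hdqM⟩ := hmem _ hdq
  have hqm : q ≤ 2 * m := (Nat.le_mul_of_pos_left q hd).trans hdqm
  set i := 2 * q / b + 1 with hi
  have hi1 : 2 * q ≤ i * b := by
    rw [hi, mul_comm _ b]
    exact (Nat.lt_mul_div_succ (2 * q) hb0).le
  have hi2 : i * b ≤ 3 * q := by
    have := Nat.div_mul_le_self (2 * q) b
    rw [hi, add_mul]; omega
  set w := m / q + 1 with hw
  have hw1 : m ≤ w * q := by
    rw [hw, mul_comm]
    exact (Nat.lt_mul_div_succ m (hb0.trans_le hbq)).le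
  have hw2 : w * b ≤ m + q := by
    have h1 := Nat.div_mul_le_self m q
    have h2 : w * b ≤ w * q := Nat.mul_le_mul_left w hbq
    have h3 : w * q = m / q * q + q := by rw [hw, add_mul, one_mul]
    omega
  refine ⟨d, (i + i) * q, hd, ?_, ?_, ?_⟩
  · nlinarith
  · have h0 : i * b ≤ 6 * m := by omega
    have h1 : D.card * (d * ((i + i) * q)) ≤ 2 * b * (d * ((i + i) * q)) := by gcongr
    have h2 : 2 * b * (d * ((i + i) * q)) = 4 * (i * b) * (d * q) := by ring
    have h3 : 4 * (i * b) * (d * q) ≤ 4 * (6 * m) * (2 * M) := by gcongr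
    linarith
  · intro y hy1 hy2
    obtain ⟨Z, hZ, hZc, hZs⟩ := hAP i w y hi1 hy1 (by rw [add_mul (i + i)]; omega)
    obtain ⟨U, hU, _, hUs⟩ := exists_le_nsmul_val_sum_eq D r u hr Z
      (fun z hz => (Finset.mem_filter.1 (hZ z hz)).2) (by
        have h1 : b * (8 * Multiset.card Z) ≤ b * (r * u) := by nlinarith
        exact Nat.le_of_mul_le_mul_left h1 hb0)
    exact ⟨U, hU, hUs.trans hZs⟩

theorem Multiset.exists_le_card_eq_of_le_card {α : Type*} (X : Multiset α) (k : ℕ)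
    (h : k ≤ Multiset.card X) : ∃ Y ≤ X, Multiset.card Y = k := by
  induction X using Quotient.inductionOn with
  | h l => exact ⟨(l.take k : List α), (List.take_sublist k l).subperm, by simpa using h⟩

theorem Multiset.sum_le_sum_of_le_nat {Y X : Multiset ℕ} (h : Y ≤ X) : Y.sum ≤ X.sum := by
  obtain ⟨Z, rfl⟩ := Multiset.le_iff_exists_add.1 h
  simp

theorem Multiset.card_filter_eq_sum_map {α : Type*} (p : α → Prop) [DecidablePred p]
    (s : Multiset α) : Multiset.card (s.filter p) = (s.map fun x => if p x then 1 else 0).sum := by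
  induction s using Multiset.induction_on with
  | empty => simp
  | cons x s ih => by_cases h : p x <;> simp [h, ih, add_comm]

theorem exists_nsmul_val_le (Y : Multiset ℕ) (hY : Y ≠ 0) (μ : ℕ) (hμ : ∀ x, Y.count x ≤ μ) :
    ∃ r : ℕ, 0 < r ∧ r ≤ μ ∧ ∃ D : Finset ℕ, D.Nonempty ∧ r • D.val ≤ Y ∧
      (Multiset.card Y : ℝ) ≤ Real.logb 2 (2 * μ) * (r * D.card) := by
  have hμ0 : 0 < μ := by
    obtain ⟨x, hx⟩ := Multiset.exists_mem_of_ne_zero hY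
    exact (Multiset.count_pos.2 hx).trans_le (hμ x)
  set L := Nat.log 2 μ + 1 with hL
  let D : ℕ → Finset ℕ := fun i => Y.toFinset.filter fun x => 2 ^ i ≤ Y.count x
  have hsum : Multiset.card Y ≤ ∑ i ∈ Finset.range L, 2 ^ i * (D i).card := by
    have h1 : ∀ i, 2 ^ i * (D i).card =
        ∑ x ∈ Y.toFinset, if 2 ^ i ≤ Y.count x then 2 ^ i else 0 := by
      intro i
      rw [← Finset.sum_filter, Finset.sum_const, smul_eq_mul, mul_comm]
    simp_rw [h1]
    rw [Finset.sum_comm, ← Multiset.toFinset_sum_count_eq]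
    refine Finset.sum_le_sum fun x hx => ?_
    have hc : Y.count x ≠ 0 := (Multiset.count_pos.2 (Multiset.mem_toFinset.1 hx)).ne'
    calc Y.count x ≤ ∑ i ∈ Finset.range (Nat.log 2 (Y.count x) + 1), 2 ^ i := by
          have h2 := Nat.lt_pow_succ_log_self one_lt_two (Y.count x)
          have h3 := Nat.geomSum_eq le_rfl (Nat.log 2 (Y.count x) + 1)
          simp only [Nat.add_one_sub_one, Nat.div_one, Nat.succ_eq_add_one] at h2 h3 ⊢
          omega
      _ = ∑ i ∈ Finset.range (Nat.log 2 (Y.count x) + 1),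
            if 2 ^ i ≤ Y.count x then 2 ^ i else 0 := by
          refine Finset.sum_congr rfl fun i hi => ?_
          rw [if_pos]
          exact Nat.pow_le_of_le_log hc (Nat.lt_succ_iff.1 (Finset.mem_range.1 hi))
      _ ≤ _ := by
          apply Finset.sum_le_sum_of_subset
          apply Finset.range_subset_range.2
          exact Nat.succ_le_succ (Nat.log_mono_right (hμ x))
  have hex : ∃ i ∈ Finset.range L, Multiset.card Y ≤ L * (2 ^ i * (D i).card) := by
    by_contra! hcon
    have h1 : ∑ i ∈ Finset.range L, L * (2 ^ i * (D i).card) <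
        ∑ i ∈ Finset.range L, Multiset.card Y :=
      Finset.sum_lt_sum_of_nonempty (by simp [hL]) hcon
    rw [← Finset.mul_sum, Finset.sum_const, Finset.card_range, smul_eq_mul] at h1
    exact absurd (Nat.mul_le_mul_left L hsum) (not_le.2 h1)
  obtain ⟨i, hi, hcard⟩ := hex
  have hYc : 0 < Multiset.card Y := Multiset.card_pos.2 hY
  refine ⟨2 ^ i, by positivity, Nat.pow_le_of_le_log hμ0.ne'
    (Nat.lt_succ_iff.1 (Finset.mem_range.1 hi)), D i, ?_, ?_, ?_⟩
  · rw [← Finset.card_pos, Nat.pos_iff_ne_zero]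
    intro h0
    rw [h0] at hcard
    simp at hcard
    exact hY hcard
  · rw [Multiset.le_iff_count]
    intro x
    rw [Multiset.count_nsmul, Multiset.count_eq_of_nodup (D i).nodup]
    by_cases hx : x ∈ D i
    · simpa [hx] using (Finset.mem_filter.1 hx).2
    · simp [hx]
  · have h1 : (L : ℝ) ≤ Real.logb 2 (2 * μ) := by
      have := Real.natLog_le_logb μ 2
      rw [Real.logb_mul (by norm_num) (by positivity), Real.logb_self_eq_one (by norm_num), hL]
      push_cast at this ⊢
      linarith
    calc (Multiset.card Y : ℝ) ≤ L * (2 ^ i * (D i).card : ℕ) := by exact_mod_cast hcard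
      _ ≤ Real.logb 2 (2 * μ) * (2 ^ i * (D i).card : ℕ) := by gcongr
      _ = _ := by push_cast; ring

theorem ZMod.exists_dvd_of_addSubgroup_ne_top (d : ℕ) (hd : 0 < d) (K : AddSubgroup (ZMod d))
    (hK : K ≠ ⊤) : ∃ e : ℕ, 1 < e ∧ ∀ x : ℕ, (x : ZMod d) ∈ K → e ∣ x := by
  by_contra! hcon
  apply hK
  obtain ⟨a, ha⟩ := Int.subgroup_cyclic (K.comap (Int.castAddHom (ZMod d)))
  have hmem : ∀ x : ℤ, (x : ZMod d) ∈ K ↔ a ∣ x := by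
    intro x
    rw [← Int.mem_zmultiples_iff, AddSubgroup.zmultiples_eq_closure, ← ha]
    simp
  have hdvd : ∀ x : ℕ, (x : ZMod d) ∈ K ↔ a.natAbs ∣ x := by
    intro x
    rw [← Int.cast_natCast, hmem, ← Int.natAbs_dvd_natAbs, Int.natAbs_natCast]
  have h0 : a.natAbs ≠ 0 := by
    have : a.natAbs ∣ d := (hdvd d).1 (by simp)
    exact (Nat.pos_of_dvd_of_pos this hd).ne'
  have h1 : a.natAbs = 1 := by
    by_contra h1
    obtain ⟨x, hx, hx'⟩ := hcon a.natAbs (by omega)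
    exact hx' ((hdvd x).1 hx)
  rw [eq_top_iff]
  intro x _
  obtain ⟨y, rfl⟩ := ZMod.intCast_surjective x
  rw [hmem]
  exact (Int.isUnit_iff_natAbs_eq.2 h1).dvd

open scoped Pointwise in
theorem exists_le_complete_residues (R : Multiset ℕ) (d : ℕ) (hd : 0 < d)
    (hR : ∀ e : ℕ, 1 < e → d ≤ Multiset.card (R.filter fun x => ¬ e ∣ x)) :
    ∃ Q ≤ R, Multiset.card Q < d ∧ ∀ a : ℕ, ∃ P ≤ Q, P.sum ≡ a [MOD d] := by
  have : NeZero d := ⟨hd.ne'⟩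
  let S : Multiset ℕ → Finset (ZMod d) := fun Q =>
    Q.powerset.toFinset.image fun P => (P.sum : ZMod d)
  have hS : ∀ Q a, a ∈ S Q ↔ ∃ P ≤ Q, (P.sum : ZMod d) = a := by
    intro Q a; simp [S]
  obtain ⟨Q, hQ, hmax⟩ := Finset.exists_max_image
    (R.powerset.toFinset.filter fun Q => Multiset.card Q + 1 ≤ (S Q).card) Multiset.card
    ⟨0, by simp [S]⟩
  simp only [Finset.mem_filter, Multiset.mem_toFinset, Multiset.mem_powerset] at hQ hmax
  obtain ⟨hQR, hQc⟩ := hQ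
  have hle : (S Q).card ≤ d := by simpa [ZMod.card] using Finset.card_le_univ (S Q)
  refine ⟨Q, hQR, by omega, ?_⟩
  by_cases huniv : S Q = Finset.univ
  · intro a
    obtain ⟨P, hP, hPa⟩ := (hS Q a).1 (huniv ▸ Finset.mem_univ _)
    exact ⟨P, hP, (ZMod.natCast_eq_natCast_iff _ _ _).1 hPa⟩
  exfalso
  have h0 : (0 : ZMod d) ∈ S Q := (hS Q 0).2 ⟨0, Multiset.zero_le _, by simp⟩
  have hstuck : ∀ x ∈ R - Q, (x : ZMod d) ∈ AddAction.stabilizer (ZMod d) (S Q) := by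
    intro x hx
    have hsub : S Q ⊆ S (x ::ₘ Q) := by
      intro a ha
      obtain ⟨P, hP, hPa⟩ := (hS _ _).1 ha
      exact (hS _ _).2 ⟨P, hP.trans (Multiset.le_cons_self _ _), hPa⟩
    have hxR : x ::ₘ Q ≤ R := by
      rw [← Multiset.singleton_add, ← Multiset.sub_add_cancel hQR]
      gcongr
      exact Multiset.singleton_le.2 hx
    have heq : S Q = S (x ::ₘ Q) := by
      apply Finset.eq_of_subset_of_card_le hsub
      by_contra hlt
      have := hmax (x ::ₘ Q) ⟨hxR, by rw [Multiset.card_cons]; omega⟩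
      rw [Multiset.card_cons] at this
      omega
    rw [AddAction.mem_stabilizer_iff]
    apply Finset.eq_of_subset_of_card_le _ (by simp)
    intro z hz
    obtain ⟨a, ha, rfl⟩ := Finset.mem_vadd_finset.1 hz
    obtain ⟨P, hP, rfl⟩ := (hS _ _).1 ha
    rw [heq]
    exact (hS _ _).2 ⟨x ::ₘ P, (Multiset.cons_le_cons_iff x).2 hP, by simp⟩
  obtain ⟨e, he, hdvd⟩ := ZMod.exists_dvd_of_addSubgroup_ne_top d hd
    (AddAction.stabilizer (ZMod d) (S Q)) (by
      intro htop
      apply huniv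
      ext z
      simp only [Finset.mem_univ, iff_true]
      have hz : z ∈ AddAction.stabilizer (ZMod d) (S Q) := by rw [htop]; trivial
      rw [AddAction.mem_stabilizer_iff] at hz
      rw [← hz, Finset.mem_vadd_finset]
      exact ⟨0, h0, by simp⟩)
  have hfil : (R.filter fun x => ¬ e ∣ x) ≤ Q := by
    rw [← Multiset.sub_add_cancel hQR, Multiset.filter_add,
      Multiset.filter_eq_nil.2 fun x hx => not_not.2 (hdvd x (hstuck x hx)), zero_add]
    exact Multiset.filter_le _ _
  have := Multiset.card_le_card hfil
  have := hR e he
  omega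

theorem Nat.card_filter_prime_dvd_le_log (P : Finset ℕ) (hP : ∀ p ∈ P, p.Prime) (x : ℕ)
    (hx : 0 < x) : (P.filter fun p => p ∣ x).card ≤ Nat.log 2 x := by
  have h1 : (P.filter fun p => p ∣ x) ⊆ x.primeFactors := by
    intro p hp
    obtain ⟨hp, hpx⟩ := Finset.mem_filter.1 hp
    exact Nat.mem_primeFactors.2 ⟨hP p hp, hpx, hx.ne'⟩
  refine (Finset.card_le_card h1).trans (Nat.le_log_of_pow_le one_lt_two ?_)
  calc 2 ^ x.primeFactors.card ≤ ∏ p ∈ x.primeFactors, p :=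
        Finset.pow_card_le_prod _ _ _ fun p hp => (Nat.prime_of_mem_primeFactors hp).two_le
    _ ≤ x := Nat.le_of_dvd hx (Nat.prod_primeFactors_dvd x)

theorem exists_le_forall_card_filter_not_dvd (X : Multiset ℕ) (T m : ℕ)
    (hpos : ∀ x ∈ X, 0 < x) (hm : ∀ x ∈ X, x ≤ m) (hT : 2 * T ≤ Multiset.card X)
    (hX : ∀ e : ℕ, 1 < e → T ≤ Multiset.card (X.filter fun x => ¬ e ∣ x)) :
    ∃ R ≤ X, Multiset.card R ≤ 2 * T + 2 * Nat.log 2 m * T ∧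
      ∀ e : ℕ, 1 < e → T ≤ Multiset.card (R.filter fun x => ¬ e ∣ x) := by
  rcases Nat.eq_zero_or_pos T with rfl | hT0
  · exact ⟨0, Multiset.zero_le _, by simp, by simp⟩
  obtain ⟨R₀, hR₀, hR₀c⟩ := X.exists_le_card_eq_of_le_card (2 * T) hT
  set P := (Finset.range (m + 1)).filter fun p =>
    p.Prime ∧ Multiset.card (R₀.filter fun x => ¬ p ∣ x) < T with hP
  have hPcard : P.card ≤ 2 * Nat.log 2 m := by
    have h1 : P.card * T ≤ ∑ p ∈ P, Multiset.card (R₀.filter fun x => p ∣ x) := by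
      rw [← smul_eq_mul, ← Finset.sum_const]
      refine Finset.sum_le_sum fun p hp => ?_
      have h2 := (Finset.mem_filter.1 hp).2.2
      have h3 := congrArg Multiset.card (Multiset.filter_add_not (fun x => p ∣ x) R₀)
      rw [Multiset.card_add] at h3
      omega
    have h2 : ∑ p ∈ P, Multiset.card (R₀.filter fun x => p ∣ x) =
        (R₀.map fun x => (P.filter fun p => p ∣ x).card).sum := by
      simp_rw [Finset.card_filter]
      rw [Multiset.sum_map_sum]
      refine Finset.sum_congr rfl fun p _ => ?_
      exact Multiset.card_filter_eq_sum_map _ _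
    have h3 : (R₀.map fun x => (P.filter fun p => p ∣ x).card).sum ≤ 2 * T * Nat.log 2 m := by
      rw [← hR₀c]
      refine (Multiset.sum_le_card_nsmul _ (Nat.log 2 m) ?_).trans (by simp)
      intro y hy
      obtain ⟨x, hx, rfl⟩ := Multiset.mem_map.1 hy
      have hxX := Multiset.mem_of_le hR₀ hx
      exact (Nat.card_filter_prime_dvd_le_log P (fun p hp => (Finset.mem_filter.1 hp).2.1) x
        (hpos x hxX)).trans (Nat.log_mono_right (hm x hxX))
    have h4 : P.card * T ≤ 2 * Nat.log 2 m * T := by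
      calc _ ≤ _ := h1.trans (h2.trans_le h3)
        _ = _ := by ring
    exact Nat.le_of_mul_le_mul_right h4 hT0
  have hext : ∀ P' : Finset ℕ, P' ⊆ P → ∃ R ≤ X, R₀ ≤ R ∧
      Multiset.card R ≤ 2 * T + P'.card * T ∧
      ∀ p ∈ P', T ≤ Multiset.card (R.filter fun x => ¬ p ∣ x) := by
    intro P'
    induction P' using Finset.induction_on with
    | empty => intro _; exact ⟨R₀, hR₀, le_rfl, by simp [hR₀c], by simp⟩
    | insert p P' hp ih =>
      intro hsub
      obtain ⟨R, hRX, hR₀R, hRc, hRP⟩ := ih ((Finset.subset_insert _ _).trans hsub)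
      have hpP := (Finset.mem_filter.1 (hsub (Finset.mem_insert_self p P'))).2.1
      obtain ⟨W, hW, hWc⟩ := (X.filter fun x => ¬ p ∣ x).exists_le_card_eq_of_le_card T
        (hX p hpP.one_lt)
      refine ⟨R ∪ W, Multiset.union_le hRX (hW.trans (Multiset.filter_le _ _)),
        hR₀R.trans Multiset.le_union_left, ?_, ?_⟩
      · have := Multiset.card_le_card (Multiset.union_le_add R W)
        rw [Multiset.card_add] at this
        rw [Finset.card_insert_of_notMem hp, add_mul]
        omega
      · intro p' hp'
        rcases Finset.mem_insert.1 hp' with rfl | hp'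
        · rw [← hWc]
          apply Multiset.card_le_card
          rw [Multiset.le_filter]
          exact ⟨Multiset.le_union_right, fun x hx => (Multiset.mem_filter.1
            (Multiset.mem_of_le hW hx)).2⟩
        · exact (hRP p' hp').trans (Multiset.card_le_card
            (Multiset.filter_le_filter _ Multiset.le_union_left))
  obtain ⟨R, hRX, hR₀R, hRc, hRP⟩ := hext P subset_rfl
  refine ⟨R, hRX, hRc.trans (by gcongr), ?_⟩
  have hprime : ∀ p : ℕ, p.Prime → T ≤ Multiset.card (R.filter fun x => ¬ p ∣ x) := by
    intro p hp
    by_cases hp0 : Multiset.card (R₀.filter fun x => ¬ p ∣ x) < T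
    · apply hRP
      refine Finset.mem_filter.2 ⟨?_, hp, hp0⟩
      have h3 := congrArg Multiset.card (Multiset.filter_add_not (fun x => p ∣ x) R₀)
      rw [Multiset.card_add] at h3
      obtain ⟨x, hx⟩ := Multiset.card_pos_iff_exists_mem.1
        (by omega : 0 < Multiset.card (R₀.filter fun x => p ∣ x))
      obtain ⟨hx, hpx⟩ := Multiset.mem_filter.1 hx
      have hxX := Multiset.mem_of_le hR₀ hx
      have := Nat.le_of_dvd (hpos x hxX) hpx
      have := hm x hxX
      exact Finset.mem_range.2 (by omega)
    · push Not at hp0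
      exact hp0.trans (Multiset.card_le_card (Multiset.filter_le_filter _ hR₀R))
  intro e he
  refine (hprime e.minFac (Nat.minFac_prime he.ne')).trans (Multiset.card_le_card ?_)
  exact Multiset.monotone_filter_right R fun x hx hex => hx ((Nat.minFac_dvd e).trans hex)

theorem exists_le_sum_near (G : Multiset ℕ) (m lo : ℕ) (hm : ∀ x ∈ G, x ≤ m) (hlo : lo ≤ G.sum) :
    ∃ Y ≤ G, lo ≤ Y.sum ∧ Y.sum ≤ lo + m ∧ (lo = 0 → Y.sum = 0) := by
  rcases Nat.eq_zero_or_pos lo with rfl | hlo0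
  · exact ⟨0, Multiset.zero_le _, by simp⟩
  induction G using Multiset.induction_on with
  | empty => simp at hlo; omega
  | cons x G ih =>
    by_cases h : lo ≤ G.sum
    · obtain ⟨Y, hY, h1⟩ := ih (fun y hy => hm y (Multiset.mem_cons_of_mem hy)) h
      exact ⟨Y, hY.trans (Multiset.le_cons_self _ _), h1⟩
    · have := hm x (Multiset.mem_cons_self _ _)
      refine ⟨x ::ₘ G, le_rfl, hlo, ?_, by omega⟩
      rw [Multiset.sum_cons]; omega

theorem exists_le_sum_eq_of_progression (X A Q : Multiset ℕ) (hAQ : A + Q ≤ X) (d y₀ m t : ℕ)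
    (hd : 0 < d) (hm : ∀ x ∈ X, x ≤ m)
    (hA : ∀ y, y₀ ≤ y → y ≤ y₀ + m → ∃ U ≤ A, U.sum = d * y)
    (hQ : ∀ a : ℕ, ∃ P ≤ Q, P.sum ≡ a [MOD d]) (hQc : Multiset.card Q < d)
    (ht : d * y₀ + d * m ≤ t) (hsum : t + A.sum + Q.sum ≤ X.sum) : ∃ Y ≤ X, Y.sum = t := by
  obtain ⟨G, rfl⟩ := Multiset.le_iff_exists_add.1 hAQ
  rw [Multiset.sum_add, Multiset.sum_add] at hsum
  obtain ⟨Y, hY, hY1, hY2, hY3⟩ := exists_le_sum_near G m (t - d * (y₀ + m))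
    (fun x hx => hm x (Multiset.mem_add.2 (Or.inr hx))) (by omega)
  have hYt : Y.sum + d * y₀ + d * m ≤ t + m := by
    rcases Nat.eq_zero_or_pos (t - d * (y₀ + m)) with h | h
    · have := hY3 h; omega
    · rw [mul_add] at h hY2; omega
  have hdm : d * m = (d - 1) * m + m := by
    conv_lhs => rw [← Nat.sub_add_cancel hd]
    ring
  obtain ⟨P, hP, hPs⟩ := hQ (t - Y.sum)
  have hPm : P.sum ≤ (d - 1) * m := by
    refine (Multiset.sum_le_card_nsmul P m fun x hx => hm x (Multiset.mem_add.2 (Or.inl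
      (Multiset.mem_add.2 (Or.inr (Multiset.mem_of_le hP hx)))))).trans ?_
    rw [smul_eq_mul]
    have := Multiset.card_le_card hP
    gcongr
    omega
  obtain ⟨y, hy⟩ := (Nat.modEq_iff_dvd' (by omega : P.sum ≤ t - Y.sum)).1 hPs
  obtain ⟨U, hU, hUs⟩ := hA y
    (Nat.le_of_mul_le_mul_left (by omega : d * y₀ ≤ d * y) hd)
    (Nat.le_of_mul_le_mul_left (by omega : d * y ≤ d * (y₀ + m)) hd)
  refine ⟨U + P + Y, by gcongr, ?_⟩
  rw [Multiset.sum_add, Multiset.sum_add, hUs]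
  omega

theorem exists_uniform_sub_of_dense (X : Multiset ℕ) (μ m k₀ : ℕ) (ℓ ℓn : ℝ)
    (hℓ : ℓ = Real.logb 2 (2 * μ)) (hℓn : ℓn = Real.logb 2 (2 * Multiset.card X))
    (hℓ1 : 1 ≤ ℓ) (hℓn1 : 1 ≤ ℓn) (hμ : ∀ x, X.count x ≤ μ) (hm0 : 0 < m) (hs : 0 < X.sum)
    (hdense : 1699200 * ℓn * ℓ ^ 2 * μ * m ≤ (Multiset.card X : ℝ) ^ 2)
    (W : Multiset ℕ) (hW : W ≤ X) (hk₀ : 10 * k₀ ≤ Multiset.card X)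
    (hWc : Multiset.card X ≤ Multiset.card W + k₀) (hn : 100 ≤ Multiset.card X) :
    ∃ r : ℕ, 0 < r ∧ r ≤ μ ∧ ∃ D : Finset ℕ, D.Nonempty ∧ r • D.val ≤ W ∧
      (∀ x ∈ D, x ≤ 2 * X.sum / Multiset.card X) ∧ 4 * (r • D.val).sum ≤ X.sum ∧
      (Multiset.card X : ℝ) ≤ 9 * ℓ * (r * D.card) ∧
      432 * m * Real.logb 2 (2 * D.card) ≤ r * (D.card : ℝ) ^ 2 := by
  set n := Multiset.card X with hn_def
  have hn0 : 0 < n := by omega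
  set V := W.filter fun x => x * n ≤ 2 * X.sum with hV
  have hbig : 2 * Multiset.card (X.filter fun x => ¬ x * n ≤ 2 * X.sum) ≤ n := by
    set F := X.filter fun x => ¬ x * n ≤ 2 * X.sum with hF
    have h1 : Multiset.card (F.map (· * n)) • (2 * X.sum) ≤ (F.map (· * n)).sum := by
      apply Multiset.card_nsmul_le_sum
      intro y hy
      obtain ⟨x, hx, rfl⟩ := Multiset.mem_map.1 hy
      exact (not_le.1 (Multiset.mem_filter.1 hx).2).le
    rw [Multiset.card_map, Multiset.sum_map_mul_right, Multiset.map_id', smul_eq_mul] at h1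
    have h2 : F.sum ≤ X.sum := Multiset.sum_le_sum_of_le_nat (Multiset.filter_le _ _)
    have h3 : X.sum * (2 * Multiset.card F) ≤ X.sum * n := by nlinarith
    exact Nat.le_of_mul_le_mul_left h3 hs
  have hVc : n / 8 ≤ Multiset.card V := by
    have h1 := congrArg Multiset.card (Multiset.filter_add_not (fun x => x * n ≤ 2 * X.sum) W)
    rw [Multiset.card_add, ← hV] at h1
    have h2 : Multiset.card (W.filter fun x => ¬ x * n ≤ 2 * X.sum) ≤
        Multiset.card (X.filter fun x => ¬ x * n ≤ 2 * X.sum) :=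
      Multiset.card_le_card (Multiset.filter_le_filter _ hW)
    omega
  obtain ⟨Y, hYV, hYc⟩ := V.exists_le_card_eq_of_le_card (n / 8) hVc
  have hYW : Y ≤ W := hYV.trans (Multiset.filter_le _ _)
  have hYM : ∀ x ∈ Y, x * n ≤ 2 * X.sum := fun x hx =>
    (Multiset.mem_filter.1 (Multiset.mem_of_le hYV hx)).2
  have hYsum : 4 * Y.sum ≤ X.sum := by
    have h1 := Multiset.sum_le_card_nsmul (Y.map (· * n)) (2 * X.sum) (by
      intro y hy
      obtain ⟨x, hx, rfl⟩ := Multiset.mem_map.1 hy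
      exact hYM x hx)
    rw [Multiset.card_map, Multiset.sum_map_mul_right, Multiset.map_id', smul_eq_mul, hYc] at h1
    have h2 : 8 * (n / 8) ≤ n := Nat.mul_div_le n 8
    have h3 : n * (4 * Y.sum) ≤ n * X.sum := by nlinarith
    exact Nat.le_of_mul_le_mul_left h3 hn0
  obtain ⟨r, hr, hrμ, D, hD, hDY, hcard⟩ := exists_nsmul_val_le Y
    (by rw [← Multiset.card_pos, hYc]; omega) μ
    (fun x => (Multiset.count_le_of_le x (hYW.trans hW)).trans (hμ x))
  have hDX : ∀ x ∈ D, x ∈ Y := fun x hx => Multiset.mem_of_le hDY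
    ((Multiset.mem_nsmul_of_ne_zero hr.ne').2 hx)
  have hk0 : 0 < D.card := Finset.card_pos.2 hD
  have hkn : D.card ≤ n := by
    have h1 := Multiset.card_le_card (hDY.trans (hYW.trans hW))
    rw [Multiset.card_nsmul, Finset.card_val] at h1
    exact (Nat.le_mul_of_pos_left _ hr).trans h1
  have hn9 : (n : ℝ) ≤ 9 * ℓ * (r * D.card) := by
    have h1 : (n : ℝ) ≤ 9 * (n / 8 : ℕ) := by
      have : n ≤ 9 * (n / 8) := by omega
      exact_mod_cast this
    rw [hYc, ← hℓ] at hcard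
    linarith
  refine ⟨r, hr, hrμ, D, hD, hDY.trans hYW, ?_, ?_, hn9, ?_⟩
  · intro x hx
    rw [Nat.le_div_iff_mul_le hn0]
    exact hYM x (hDX x hx)
  · exact (Nat.mul_le_mul_left 4 (Multiset.sum_le_sum_of_le_nat hDY)).trans hYsum
  · have hlog : Real.logb 2 (2 * D.card) ≤ ℓn := by
      rw [hℓn]
      apply Real.logb_le_logb_of_le (by norm_num) (by positivity)
      gcongr
    have hr' : (0 : ℝ) < r := by exact_mod_cast hr
    have hrμ' : (r : ℝ) ≤ μ := by exact_mod_cast hrμ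
    have h1 : (n : ℝ) ^ 2 ≤ (9 * ℓ * (r * D.card)) ^ 2 := by gcongr
    have h2 : 1699200 * ℓn * ℓ ^ 2 * r * m ≤ 1699200 * ℓn * ℓ ^ 2 * μ * m := by gcongr
    have h3 : (ℓ ^ 2 * r) * (1699200 * ℓn * m) ≤ (ℓ ^ 2 * r) * (81 * (r * (D.card : ℝ) ^ 2)) := by
      calc _ = 1699200 * ℓn * ℓ ^ 2 * r * m := by ring
        _ ≤ _ := h2.trans (hdense.trans h1)
        _ = _ := by ring
    have h4 := le_of_mul_le_mul_left h3 (by positivity)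
    have h5 : 432 * m * Real.logb 2 (2 * D.card) ≤ 432 * m * ℓn := by gcongr
    have h6 : (0 : ℝ) ≤ ℓn * m := by positivity
    nlinarith

set_option maxHeartbeats 800000 in
theorem exists_le_sum_eq_of_le_half (X : Multiset ℕ) (hpos : ∀ x ∈ X, 0 < x) (n μ m : ℕ)
    (ℓ ℓn τ : ℝ) (hn : n = Multiset.card X) (hn0 : 0 < n)
    (hℓ : ℓ = Real.logb 2 (2 * μ)) (hℓn : ℓn = Real.logb 2 (2 * n))
    (hℓ1 : 1 ≤ ℓ) (hμ0 : 0 < μ) (hμ : ∀ x, X.count x ≤ μ) (hm : ∀ x ∈ X, x ≤ m)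
    (hdense : 1699200 * ℓn * ℓ ^ 2 * μ * m ≤ (n : ℝ) ^ 2)
    (hτ : τ * (n : ℝ) ^ 2 = 42480 * ℓ * μ * X.sum)
    (hnad : ∀ e : ℕ, 1 < e → τ < Multiset.card (X.filter fun x => ¬ e ∣ x))
    (t : ℕ) (ht : 4 * τ * m ≤ t) (ht2 : 2 * t ≤ X.sum) : ∃ Y ≤ X, Y.sum = t := by
  have hn0' : (0 : ℝ) < n := by exact_mod_cast hn0
  have hn1' : (1 : ℝ) ≤ n := by exact_mod_cast hn0
  have hμ1' : (1 : ℝ) ≤ μ := by exact_mod_cast hμ0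
  have hm0 : 0 < m := by
    obtain ⟨x, hx⟩ := Multiset.card_pos_iff_exists_mem.1 (hn ▸ hn0)
    exact (hpos x hx).trans_le (hm x hx)
  have hm1' : (1 : ℝ) ≤ m := by exact_mod_cast hm0
  have hs : 0 < X.sum := by
    obtain ⟨x, hx⟩ := Multiset.card_pos_iff_exists_mem.1 (hn ▸ hn0)
    exact (hpos x hx).trans_le (Multiset.single_le_sum (fun _ _ => Nat.zero_le _) x hx)
  have hlogn : ℓn = 1 + Real.logb 2 n := by
    rw [hℓn, Real.logb_mul (by norm_num) (by positivity), Real.logb_self_eq_one (by norm_num)]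
  have hℓn1 : 1 ≤ ℓn := by
    rw [hlogn]
    have := Real.logb_nonneg (b := 2) (by norm_num) hn1'
    linarith
  have hτ0 : 0 ≤ τ := by
    have : 0 ≤ τ * (n : ℝ) ^ 2 := by rw [hτ]; positivity
    exact nonneg_of_mul_nonneg_left this (by positivity)
  have hsum : (X.sum : ℝ) ≤ n * m := by
    have := Multiset.sum_le_card_nsmul X m hm
    rw [← hn, smul_eq_mul] at this
    exact_mod_cast this
  have hτn : 40 * ℓn * ℓ * τ ≤ n := by
    have h1 : (n : ℝ) ^ 2 * (40 * ℓn * ℓ * τ) ≤ (n : ℝ) ^ 2 * n := by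
      calc (n : ℝ) ^ 2 * (40 * ℓn * ℓ * τ) = 40 * ℓn * ℓ * (τ * (n : ℝ) ^ 2) := by ring
        _ = 1699200 * ℓn * ℓ ^ 2 * μ * X.sum := by rw [hτ]; ring
        _ ≤ 1699200 * ℓn * ℓ ^ 2 * μ * (n * m) := by gcongr
        _ = (1699200 * ℓn * ℓ ^ 2 * μ * m) * n := by ring
        _ ≤ _ := by gcongr
    exact le_of_mul_le_mul_left h1 (by positivity)
  have hmn : 1699200 * (m : ℝ) ≤ (n : ℝ) ^ 2 := by
    refine le_trans ?_ hdense
    have h1 : 1 ≤ ℓn * ℓ ^ 2 * μ :=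
      one_le_mul_of_one_le_of_one_le
        (one_le_mul_of_one_le_of_one_le hℓn1 (one_le_pow₀ hℓ1)) hμ1'
    nlinarith
  have hn100 : 100 ≤ n := by
    have : (100 : ℝ) ≤ n := by nlinarith
    exact_mod_cast this
  set T := ⌊τ⌋₊ with hT
  have hTτ : (T : ℝ) ≤ τ := Nat.floor_le hτ0
  have hTn : 40 * (ℓn * T) ≤ n := by
    refine le_trans ?_ hτn
    have : ℓn * T ≤ ℓn * τ := by gcongr
    have h2 : ℓn * τ ≤ ℓ * (ℓn * τ) := le_mul_of_one_le_left (by positivity) hℓ1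
    nlinarith
  have hlogm : (Nat.log 2 m : ℝ) ≤ 2 * (ℓn - 1) := by
    refine (Real.natLog_le_logb m 2).trans ?_
    rw [hlogn, add_sub_cancel_left]
    have h1 : Real.logb 2 m ≤ Real.logb 2 ((n : ℝ) ^ 2) :=
      Real.logb_le_logb_of_le (by norm_num) (by positivity) (by linarith)
    rw [Real.logb_pow] at h1
    exact_mod_cast h1
  obtain ⟨R, hRX, hRc, hR⟩ := exists_le_forall_card_filter_not_dvd X T m hpos hm
    (by
      rw [← hn]
      have : 2 * (T : ℝ) ≤ n := by
        have : (T : ℝ) ≤ ℓn * T := le_mul_of_one_le_left (by positivity) hℓn1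
        linarith
      exact_mod_cast this)
    (fun e he => by
      have := hTτ.trans (hnad e he).le
      exact_mod_cast this)
  have hR10 : 10 * Multiset.card R ≤ n := by
    have h1 : (Multiset.card R : ℝ) ≤ 2 * T + 2 * Nat.log 2 m * T := by exact_mod_cast hRc
    have h2 : (Nat.log 2 m : ℝ) * T ≤ 2 * (ℓn - 1) * T := by gcongr
    have hT0 : (0 : ℝ) ≤ T := by positivity
    have h3 : 10 * (Multiset.card R : ℝ) ≤ n := by nlinarith
    exact_mod_cast h3
  obtain ⟨r, hr, hrμ, D, hD, hDW, hDM, hDs, hnD, hDdense⟩ := exists_uniform_sub_of_dense X μ m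
    (Multiset.card R) ℓ ℓn hℓ (hn ▸ hℓn) hℓ1 hℓn1 hμ hm0 hs (hn ▸ hdense) (X - R)
    (Multiset.sub_le_self _ _) (hn ▸ hR10)
    (by rw [Multiset.card_sub hRX]; omega) (hn ▸ hn100)
  rw [← hn] at hnD hDM
  have hDX : ∀ x ∈ D, x ∈ X := fun x hx => Multiset.mem_of_le (hDW.trans (Multiset.sub_le_self _ _))
    ((Multiset.mem_nsmul_of_ne_zero hr.ne').2 hx)
  set M := 2 * X.sum / n with hM
  have hMn : (M : ℝ) * n ≤ 2 * X.sum := by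
    have := Nat.div_mul_le_self (2 * X.sum) n
    exact_mod_cast this
  obtain ⟨d, y₀, hd, hdM, hy₀, hAP⟩ := exists_homogeneous_progression D hD
    (fun x hx => hpos x (hDX x hx)) r m M hr (fun x hx => hm x (hDX x hx)) hDM hDdense
  have hrμ' : (r : ℝ) ≤ μ := by exact_mod_cast hrμ
  have hbound : ∀ a c : ℝ, 0 ≤ a → 0 ≤ c → D.card * a ≤ c * M →
      a * n ^ 2 ≤ c * (18 * ℓ * μ * X.sum) := by
    intro a c ha hc h
    calc a * (n : ℝ) ^ 2 = n * (a * n) := by ring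
      _ ≤ (9 * ℓ * (r * D.card)) * (a * n) := by gcongr
      _ = 9 * ℓ * r * n * (D.card * a) := by ring
      _ ≤ 9 * ℓ * r * n * (c * M) := by gcongr
      _ = 9 * ℓ * r * c * (M * n) := by ring
      _ ≤ 9 * ℓ * μ * c * (2 * X.sum) := by gcongr
      _ = _ := by ring
  have hE : (0 : ℝ) ≤ ℓ * μ * X.sum := by positivity
  have hdτ : (d : ℝ) ≤ τ := by
    have h1 := hbound d 4 (by positivity) (by norm_num) (by
      have : D.card * d ≤ 4 * M := by rw [mul_comm]; exact hdM
      exact_mod_cast this)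
    have h2 : (d : ℝ) * n ^ 2 ≤ τ * n ^ 2 := by rw [hτ]; nlinarith
    exact le_of_mul_le_mul_right h2 (by positivity)
  have hyτ : ((d * y₀ : ℕ) : ℝ) ≤ τ * m := by
    have h1 := hbound (d * y₀ : ℕ) (48 * m) (by positivity) (by positivity) (by
      have : D.card * (d * y₀) ≤ 48 * m * M := by rw [mul_assoc 48]; exact hy₀
      exact_mod_cast this)
    have h2 : ((d * y₀ : ℕ) : ℝ) * n ^ 2 ≤ (τ * m) * n ^ 2 := by
      rw [mul_right_comm, hτ]
      nlinarith [mul_nonneg hE (by linarith : (0 : ℝ) ≤ m)]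
    exact le_of_mul_le_mul_right h2 (by positivity)
  have hdT : d ≤ T := Nat.le_floor hdτ
  have hdm : ((d * m : ℕ) : ℝ) ≤ τ * m := by push_cast; gcongr
  obtain ⟨Q, hQR, hQc, hQ⟩ := exists_le_complete_residues R d hd fun e he => hdT.trans (hR e he)
  have hQs : Q.sum ≤ d * m := by
    refine (Multiset.sum_le_card_nsmul Q m fun x hx => hm x (Multiset.mem_of_le (hQR.trans hRX)
      hx)).trans ?_
    rw [smul_eq_mul]
    gcongr
  have hdm4 : 4 * (d * m) ≤ t := by
    have : 4 * ((d * m : ℕ) : ℝ) ≤ t := by linarith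
    exact_mod_cast this
  refine exists_le_sum_eq_of_progression X (r • D.val) Q ?_ d y₀ m t hd hm hAP hQ hQc ?_ ?_
  · rw [← Multiset.sub_add_cancel hRX]
    exact add_le_add hDW hQR
  · have h0 : 0 ≤ τ * m := by positivity
    have : ((d * y₀ : ℕ) : ℝ) + ((d * m : ℕ) : ℝ) ≤ t := by linarith
    exact_mod_cast this
  · omega

theorem stmt0 (X : Multiset ℕ) (hX : X ≠ 0) (hpos : ∀ x ∈ X, 0 < x)
    (n : ℕ) (hn : n = Multiset.card X)
    (Cδ Cα Clam lam : ℝ)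
    (hCδ : Cδ = 1699200 * Real.logb 2 (2 * n) * (Real.logb 2 (2 * maxMul X)) ^ 2)
    (hCα : Cα = 42480 * Real.logb 2 (2 * maxMul X))
    (hClam : Clam = 169920 * Real.logb 2 (2 * maxMul X))
    (hdense : DenseMS Cδ X)
    (hnad : ∀ d : ℕ, ¬ AlmostDivisor Cα X d)
    (hlam : lam = Clam * maxMul X * mxElt X * X.sum / (n : ℝ) ^ 2)
    (t : ℕ) (ht1 : lam ≤ (t : ℝ)) (ht2 : (t : ℝ) ≤ (X.sum : ℝ) - lam) :
    t ∈ subsetSums X := by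
  have hn0 : 0 < n := hn ▸ Multiset.card_pos.2 hX
  have hn0' : (n : ℝ) ≠ 0 := by exact_mod_cast hn0.ne'
  have hμ : ∀ x, X.count x ≤ maxMul X := fun x => by
    by_cases hx : x ∈ X
    · exact Finset.le_sup (f := fun x => X.count x) (Multiset.mem_toFinset.2 hx)
    · simp [Multiset.count_eq_zero_of_notMem hx]
  have hμ0 : 0 < maxMul X := by
    obtain ⟨x, hx⟩ := Multiset.exists_mem_of_ne_zero hX
    exact (Multiset.count_pos.2 hx).trans_le (hμ x)
  have hμ1 : (1 : ℝ) ≤ maxMul X := by exact_mod_cast hμ0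
  have hℓ1 : 1 ≤ Real.logb 2 (2 * maxMul X) := by
    rw [Real.le_logb_iff_rpow_le (by norm_num) (by positivity), Real.rpow_one]
    linarith
  have half : ∀ s : ℕ, lam ≤ s → 2 * s ≤ X.sum → ∃ Y ≤ X, Y.sum = s := fun s hs hs2 => by
    refine exists_le_sum_eq_of_le_half X hpos n (maxMul X) (mxElt X) _ _
      (Cα * maxMul X * X.sum / (n : ℝ) ^ 2) hn hn0 rfl rfl hℓ1 hμ0 hμ
      (fun x hx => Multiset.le_sup hx) ?_ ?_ ?_ s ?_ hs2
    · rw [DenseMS, hCδ, ← hn] at hdense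
      exact hdense
    · rw [hCα]
      field_simp
    · intro e he
      have h := hnad e
      rw [AlmostDivisor, ← hn, not_and, not_le] at h
      exact h he
    · refine le_of_eq_of_le ?_ hs
      rw [hlam, hCα, hClam]
      ring
  obtain h | h := le_total (2 * t) X.sum
  · exact half t ht1 h
  · have hlam0 : 0 ≤ lam := by
      rw [hlam, hClam]
      positivity
    have htX : t ≤ X.sum := by
      have : (t : ℝ) ≤ X.sum := by linarith
      exact_mod_cast this
    obtain ⟨Y, hY, hYs⟩ := half (X.sum - t) (by rw [Nat.cast_sub htX]; linarith) (by omega)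
    refine ⟨X - Y, Multiset.sub_le_self _ _, ?_⟩
    have h1 := congrArg Multiset.sum (Multiset.sub_add_cancel hY)
    rw [Multiset.sum_add] at h1
    omega
end

section
/- Let X be a finite multiset of positive integers of size n. For every integer m with 2·mx(X) ≤ m ≤ n²/(33984·μ(X)·log(2n)·log²(2μ(X))), the set of subset sums S(X) contains an arithmetic progression P = {a+s, a+2s, …, a+m·s} of length m whose step size satisfies s ≤ 4248·μ(X)·mx(X)·log(2μ(X))/n. Moreover, every element of P equals Σ(Y) for some sub-multiset Y of X with |Y| ≤ 4248·m·μ(X)·log(2μ(X))/n, and the largest element of P satisfies max(P) ≤ 4248·m·μ(X)·mx(X)·log(2μ(X))/n. -/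
open Multiset

open Finset in
open scoped Pointwise in
theorem card_union_add_add_card_inter_add_le {G : Type*} [AddCommGroup G] [DecidableEq G]
    (X Y C : Finset G) : #(X ∪ Y + C) + #(X ∩ Y + C) ≤ #(X + C) + #(Y + C) := by
  rw [Finset.union_add, ← Finset.card_union_add_card_inter (X + C)]
  exact Nat.add_le_add_left (Finset.card_le_card (Finset.inter_add_subset (s₁ := X))) _

open Finset in
open scoped Pointwise in
theorem two_mul_card_add_card_le_of_closure_eq_top {G : Type*} [AddCommGroup G] [Fintype G]
    [DecidableEq G] {A B : Finset G} (h0 : 0 ∈ B) (hB : AddSubgroup.closure (B : Set G) = ⊤)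
    (hA : A.Nonempty) (hAB : A + B ≠ univ) : 2 * #A + #B ≤ 2 * #(A + B) := by
  let S : Finset (Finset G × Finset G) :=
    univ.filter fun p => (p.1 = B ∨ p.1 = -B) ∧ p.2.Nonempty ∧ p.2 + p.1 ≠ univ
  have hS : S.Nonempty := ⟨(B, A), by simp [S, hA, hAB]⟩
  obtain ⟨⟨C, X⟩, hCX, hmin⟩ :=
    S.exists_min_image (fun p => toLex (#(p.2 + p.1) - #p.2, #p.2)) hS
  simp only [S, Finset.mem_filter, Finset.mem_univ, true_and] at hCX hmin
  obtain ⟨hC, hX, hXC⟩ := hCX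
  have hC0 : 0 ∈ C := by rcases hC with rfl | rfl <;> simp [h0]
  have hCtop : AddSubgroup.closure (C : Set G) = ⊤ := by
    rcases hC with rfl | rfl
    · exact hB
    · rw [Finset.coe_neg, AddSubgroup.closure_neg, hB]
  have hCcard : #C = #B := by rcases hC with rfl | rfl <;> simp
  have hle : ∀ {D Y : Finset G}, 0 ∈ D → #Y ≤ #(Y + D) := fun {D Y} hD =>
    Finset.card_le_card (Finset.subset_add_left Y hD)
  have hmin' : ∀ D Y : Finset G, (D = B ∨ D = -B) → Y.Nonempty → Y + D ≠ univ →
      #(X + C) - #X < #(Y + D) - #Y ∨ (#(X + C) - #X = #(Y + D) - #Y ∧ #X ≤ #Y) := by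
    intro D Y hD hY hYD
    have := hmin (D, Y) ⟨hD, hY, hYD⟩
    simpa [Prod.Lex.toLex_le_toLex] using this
  have hXCle := hle (Y := X) hC0
  -- the complement of `X + C` is also extremal, for `-C`
  have hdual : #X + #(X + C) ≤ Fintype.card G := by
    have hY : (X + C)ᶜ.Nonempty := by
      rwa [Finset.nonempty_iff_ne_empty, Ne, Finset.compl_eq_empty_iff]
    have hsub : (X + C)ᶜ + -C ⊆ Xᶜ := by
      intro z hz
      obtain ⟨y, hy, c, hc, rfl⟩ := Finset.mem_add.1 hz
      rw [Finset.mem_compl] at hy ⊢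
      intro hyc
      exact hy (Finset.mem_add.2 ⟨_, hyc, -c, by simpa using hc, by abel⟩)
    have hne : (X + C)ᶜ + -C ≠ univ := by
      intro h
      obtain ⟨x, hx⟩ := hX
      have := hsub (h ▸ Finset.mem_univ x)
      simp [hx] at this
    have h1 := hmin' (-C) _ (by rcases hC with rfl | rfl <;> simp) hY hne
    have h2 := Finset.card_le_card hsub
    have h3 := hle (D := -C) (Y := (X + C)ᶜ) (by simpa using hC0)
    have h4 := Finset.card_le_univ X
    have h5 := Finset.card_le_univ (X + C)
    rw [Finset.card_compl] at h1 h2 h3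
    omega
  have hstab : ∀ g : G, ({g} + X = X) ∨ Disjoint ({g} + X) X := by
    intro g
    by_contra! hg
    obtain ⟨hne, hdis⟩ := hg
    rw [Finset.not_disjoint_iff_nonempty_inter] at hdis
    have hcard : #({g} + X) = #X := by simp
    have hcardC : #({g} + X + C) = #(X + C) := by rw [add_assoc]; simp
    generalize {g} + X = Y at *
    have hlt : #(Y ∩ X) < #X := by
      apply Finset.card_lt_card
      refine Finset.ssubset_iff_subset_ne.2 ⟨Finset.inter_subset_right, fun h => hne ?_⟩
      have : X ⊆ Y := Finset.inter_eq_right.1 h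
      exact (Finset.eq_of_subset_of_card_le this hcard.le).symm
    have hsub : Y ∩ X + C ⊆ X + C := Finset.add_subset_add_right Finset.inter_subset_right
    have hI : Y ∩ X + C ≠ univ := fun h => hXC (Finset.univ_subset_iff.1 (h ▸ hsub))
    have h1 := hmin' C (Y ∩ X) hC hdis hI
    have h2 := card_union_add_add_card_inter_add_le Y X C
    have h3 := Finset.card_union_add_card_inter Y X
    have h4 : #(Y ∩ X) ≤ #(Y ∩ X + C) := hle hC0
    have h5 : #(Y ∪ X) ≤ #(Y ∪ X + C) := hle hC0
    have hU : Y ∪ X + C ≠ univ := fun h => by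
      rw [h, Finset.card_univ, hcardC] at h2
      have := hdis.card_pos
      omega
    have h6 := hmin' C (Y ∪ X) hC (hX.mono Finset.subset_union_right) hU
    omega
  obtain ⟨c, hc, hcX⟩ : ∃ c ∈ C, Disjoint ({c} + X) X := by
    by_contra! h
    have hall : ∀ g ∈ AddSubgroup.closure (C : Set G), {g} + X = X := by
      intro g hg
      induction hg using AddSubgroup.closure_induction with
      | mem x hx => exact (hstab x).resolve_right (h x hx)
      | zero => rw [Finset.singleton_zero, zero_add]
      | add x y _ _ hx hy => rw [← Finset.singleton_add_singleton, add_assoc, hy, hx]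
      | neg x _ hx =>
        conv_lhs => rw [← hx]
        rw [← add_assoc, Finset.singleton_add_singleton, neg_add_cancel,
          Finset.singleton_zero, zero_add]
    obtain ⟨x, hx⟩ := hX
    apply hXC
    rw [← Finset.univ_subset_iff]
    intro z _
    have hz : z ∈ X := by
      rw [← hall (z - x) (hCtop ▸ AddSubgroup.mem_top _)]
      exact Finset.mem_add.2 ⟨z - x, by simp, x, hx, by abel⟩
    exact Finset.subset_add_left X hC0 hz
  have h1 : 2 * #X ≤ #(X + C) := by
    have hsub : ({c} + X) ∪ X ⊆ X + C := Finset.union_subset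
      (by rw [add_comm]; exact Finset.add_subset_add_left (by simpa using hc))
      (Finset.subset_add_left X hC0)
    have := Finset.card_le_card hsub
    rw [Finset.card_union_of_disjoint hcX] at this
    simp at this
    omega
  have h2 : #C ≤ #(X + C) := Finset.card_le_card_add_left hX
  have h3 := hmin' B A (Or.inl rfl) hA hAB
  have h4 := hle (Y := A) h0
  omega

open Finset in
open scoped Pointwise in
theorem nsmul_eq_univ_or_mul_card_le {G : Type*} [AddCommGroup G] [Fintype G]
    [DecidableEq G] {B : Finset G} (h0 : 0 ∈ B) (hB : AddSubgroup.closure (B : Set G) = ⊤)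
    (j : ℕ) : j • B = univ ∨ j * #B ≤ 2 * #(j • B) := by
  induction j with
  | zero => simp
  | succ j ih =>
    rw [succ_nsmul]
    by_cases h : j • B + B = univ
    · exact Or.inl h
    · right
      have hj : j • B ≠ univ := fun hj => h (by
        rw [← Finset.univ_subset_iff]
        exact hj ▸ Finset.subset_add_left _ h0)
      have := two_mul_card_add_card_le_of_closure_eq_top h0 hB
        (Finset.Nonempty.nsmul ⟨0, h0⟩ : (j • B).Nonempty) h
      have := ih.resolve_left hj
      rw [add_mul]
      omega

open scoped Pointwise in
theorem exists_multiset_of_mem_nsmul_image {q : ℕ} {B : Finset ℕ} (h : ℕ) {r : ZMod q}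
    (hr : r ∈ h • B.image (Nat.cast : ℕ → ZMod q)) :
    ∃ T : Multiset ℕ, (∀ z ∈ T, z ∈ B) ∧ card T = h ∧ ((T.sum : ℕ) : ZMod q) = r := by
  induction h generalizing r with
  | zero =>
    refine ⟨0, by simp, by simp, ?_⟩
    rw [zero_nsmul, Finset.mem_zero] at hr
    simp [hr]
  | succ h ih =>
    rw [succ_nsmul] at hr
    obtain ⟨x, hx, y, hy, rfl⟩ := Finset.mem_add.1 hr
    obtain ⟨b, hb, rfl⟩ := Finset.mem_image.1 hy
    obtain ⟨T, hT, hc, hs⟩ := ih hx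
    exact ⟨b ::ₘ T, by simpa [hb] using hT, by simp [hc], by simp [hs, add_comm]⟩

theorem closure_image_natCast_eq_top {q : ℕ} {B : Finset ℕ} (hgcd : B.gcd id = 1) :
    AddSubgroup.closure ((B.image (Nat.cast : ℕ → ZMod q) : Finset (ZMod q)) : Set (ZMod q)) =
      ⊤ := by
  set S := AddSubgroup.closure
    ((B.image (Nat.cast : ℕ → ZMod q) : Finset (ZMod q)) : Set (ZMod q)) with hS
  obtain ⟨g, hg⟩ := Int.subgroup_cyclic (S.comap (Int.castAddHom (ZMod q)))
  rw [← AddSubgroup.zmultiples_eq_closure] at hg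
  have hdvd : ∀ b ∈ B, g.natAbs ∣ b := by
    intro b hb
    have : (b : ℤ) ∈ S.comap (Int.castAddHom (ZMod q)) := by
      rw [AddSubgroup.mem_comap]
      apply AddSubgroup.subset_closure
      simp only [Finset.coe_image]
      exact ⟨b, hb, by simp⟩
    rw [hg, Int.mem_zmultiples_iff] at this
    exact Int.natAbs_dvd_natAbs.2 this
  have h1 : g.natAbs = 1 := by
    have := Finset.dvd_gcd (f := id) hdvd
    rw [hgcd] at this
    exact Nat.dvd_one.1 this
  rw [eq_top_iff]
  intro x _
  obtain ⟨k, rfl⟩ := ZMod.intCast_surjective x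
  have : k ∈ S.comap (Int.castAddHom (ZMod q)) := by
    rw [hg, Int.mem_zmultiples_iff, ← Int.natAbs_dvd, h1]
    simp
  simpa using this

theorem exists_multiset_sum_eq_of_gcd_eq_one {B : Finset ℕ} {q h : ℕ} (hq : q ∈ B)
    (hB : ∀ x ∈ B, 0 < x ∧ x ≤ q) (hgcd : B.gcd id = 1) (hh : 2 * q < h * B.card)
    {y : ℕ} (hy : h * q ≤ y) :
    ∃ T : Multiset ℕ, (∀ z ∈ T, z ∈ B) ∧ T.sum = y ∧ card T ≤ h + y / q := by
  have hq0 : 0 < q := (hB q hq).1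
  have : NeZero q := ⟨hq0.ne'⟩
  have hinj : Set.InjOn (Nat.cast : ℕ → ZMod q) B := by
    intro x hx z hz hxz
    have hx' := hB x hx
    have hz' := hB z hz
    rw [ZMod.natCast_eq_natCast_iff] at hxz
    exact Nat.ModEq.eq_of_abs_lt hxz (by rw [abs_lt]; omega)
  have hcard := Finset.card_image_of_injOn hinj
  have huniv := (nsmul_eq_univ_or_mul_card_le (B := B.image (Nat.cast : ℕ → ZMod q))
    (Finset.mem_image.2 ⟨q, hq, by simp⟩) (closure_image_natCast_eq_top hgcd) h).resolve_right
    (by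
      intro hle
      rw [hcard] at hle
      have := hle.trans (Nat.mul_le_mul_left 2 (Finset.card_le_univ _))
      rw [ZMod.card] at this
      omega)
  obtain ⟨T, hT, hc, hs⟩ := exists_multiset_of_mem_nsmul_image h
    (r := (y : ZMod q)) (huniv ▸ Finset.mem_univ _)
  have hTle : T.sum ≤ y := by
    refine le_trans ?_ hy
    have := Multiset.sum_le_card_nsmul T q fun x hx => (hB x (hT x hx)).2
    rwa [hc, smul_eq_mul] at this
  rw [ZMod.natCast_eq_natCast_iff] at hs
  obtain ⟨t, ht⟩ := (Nat.modEq_iff_dvd' hTle).1 hs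
  refine ⟨T + Multiset.replicate t q, ?_, ?_, ?_⟩
  · intro z hz
    rcases Multiset.mem_add.1 hz with hz | hz
    · exact hT z hz
    · rwa [Multiset.eq_of_mem_replicate hz]
  · rw [Multiset.sum_add, Multiset.sum_replicate, smul_eq_mul, mul_comm]
    omega
  · rw [Multiset.card_add, Multiset.card_replicate, hc]
    gcongr
    rw [Nat.le_div_iff_mul_le hq0, mul_comm]
    omega

theorem exists_arithmetic_progression_multiset_sums {B : Finset ℕ} (hne : B.Nonempty) {l m : ℕ}
    (hB : ∀ x ∈ B, 0 < x ∧ x ≤ l) (hlm : l ≤ m) :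
    ∃ a d : ℕ, 0 < d ∧ d * B.card ≤ l ∧ ∀ i : ℕ, i ≤ m →
      ∃ T : Multiset ℕ, (∀ z ∈ T, z ∈ B) ∧ T.sum = a + i * d ∧ card T * B.card ≤ 7 * m := by
  set d := B.gcd id with hd
  have hddvd : ∀ x ∈ B, d ∣ x := fun x hx => Finset.gcd_dvd hx
  obtain ⟨x₀, hx₀⟩ := hne
  have hd0 : 0 < d := Nat.pos_of_dvd_of_pos (hddvd x₀ hx₀) (hB x₀ hx₀).1
  set C := B.image (· / d) with hC
  have hgcd : C.gcd id = 1 := by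
    rw [hC, Finset.gcd_image]
    exact Finset.gcd_div_id_eq_one hx₀ (hB x₀ hx₀).1.ne'
  have hcard : C.card = B.card := by
    apply Finset.card_image_of_injOn
    intro x hx y hy hxy
    exact (Nat.div_left_inj (hddvd x hx) (hddvd y hy)).1 hxy
  have hCne : C.Nonempty := ⟨x₀ / d, Finset.mem_image_of_mem _ hx₀⟩
  set q := C.max' hCne with hq
  have hqC : q ∈ C := C.max'_mem hCne
  have hCq : ∀ x ∈ C, 0 < x ∧ x ≤ q := by
    intro x hx
    refine ⟨?_, C.le_max' x hx⟩
    obtain ⟨y, hy, rfl⟩ := Finset.mem_image.1 hx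
    exact Nat.div_pos (Nat.le_of_dvd (hB y hy).1 (hddvd y hy)) hd0
  have hmemC : ∀ x ∈ C, d * x ∈ B := by
    intro x hx
    obtain ⟨y, hy, rfl⟩ := Finset.mem_image.1 hx
    rwa [Nat.mul_div_cancel' (hddvd y hy)]
  have hdq : d * q ≤ l := (hB _ (hmemC q hqC)).2
  have hbq : B.card ≤ q := by
    rw [← hcard]
    have : C ⊆ Finset.Icc 1 q := fun x hx => Finset.mem_Icc.2 (hCq x hx)
    simpa using Finset.card_le_card this
  have hb0 : 0 < B.card := Finset.card_pos.2 ⟨x₀, hx₀⟩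
  set b := B.card with hb
  have hqm : q ≤ m := by nlinarith
  set h := 2 * q / b + 1 with hh
  have hhb : 2 * q < h * b := by
    have := Nat.lt_div_mul_add (a := 2 * q) hb0
    rw [hh]; linarith
  have hhb' : h * b ≤ 2 * q + b := by
    have := Nat.div_mul_le_self (2 * q) b
    rw [hh]; linarith
  refine ⟨h * q * d, d, hd0, (Nat.mul_le_mul_left d hbq).trans hdq, fun i hi => ?_⟩
  obtain ⟨T, hT, hs, hc⟩ := exists_multiset_sum_eq_of_gcd_eq_one hqC hCq hgcd
    (h := h) (by rwa [hcard]) (y := h * q + i) (by omega)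
  refine ⟨T.map (d * ·), ?_, ?_, ?_⟩
  · intro z hz
    obtain ⟨x, hx, rfl⟩ := Multiset.mem_map.1 hz
    exact hmemC x (hT x hx)
  · rw [Multiset.sum_map_mul_left, Multiset.map_id', hs]
    ring
  · rw [Multiset.card_map]
    have hq0 : 0 < q := (hCq q hqC).1
    have h1 : (h * q + i) / q = h + i / q := by
      rw [mul_comm, Nat.mul_add_div hq0]
    have h2 : i / q * b ≤ m :=
      (Nat.mul_le_mul_left _ hbq).trans ((Nat.div_mul_le_self i q).trans hi)
    rw [h1] at hc
    calc card T * b ≤ (h + (h + i / q)) * b := Nat.mul_le_mul_right b hc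
      _ = 2 * (h * b) + i / q * b := by ring
      _ ≤ 7 * m := by omega

theorem sum_Icc_card_filter_le {α : Type*} (s : Finset α) (f : α → ℕ) {K : ℕ}
    (hf : ∀ z ∈ s, f z ≤ K) :
    ∑ w ∈ Finset.Icc 1 K, (s.filter (w ≤ f ·)).card = ∑ z ∈ s, f z := by
  simp_rw [Finset.card_filter]
  rw [Finset.sum_comm]
  refine Finset.sum_congr rfl fun z hz => ?_
  rw [← Finset.card_filter]
  have : (Finset.Icc 1 K).filter (· ≤ f z) = Finset.Icc 1 (f z) := by
    ext w
    have := hf z hz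
    simp only [Finset.mem_filter, Finset.mem_Icc]
    omega
  rw [this]
  simp

theorem sum_Icc_inv_le_logb_two_mul {K : ℕ} (hK : 0 < K) :
    ∑ w ∈ Finset.Icc 1 K, (w : ℝ)⁻¹ ≤ Real.logb 2 (2 * K) := by
  have h := harmonic_le_one_add_log K
  rw [harmonic_eq_sum_Icc] at h
  push_cast at h
  refine h.trans ?_
  rw [Real.logb_mul (by norm_num) (by positivity), Real.logb_self_eq_one (by norm_num), Real.logb]
  have h1 : 0 ≤ Real.log K := Real.log_natCast_nonneg K
  have h2 : Real.log 2 < 1 := by linarith [Real.log_two_lt_d9]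
  have := le_div_self h1 (Real.log_pos (by norm_num : (1 : ℝ) < 2)) h2.le
  linarith

/-- The number of ordered pairs of elements of `A` with sum `z`. -/
def pairsCard (A : Finset ℕ) (z : ℕ) : ℕ :=
  ((A ×ˢ A).filter fun p => p.1 + p.2 = z).card

theorem pairsCard_le_card (A : Finset ℕ) (z : ℕ) : pairsCard A z ≤ A.card := by
  refine Finset.card_le_card_of_injOn Prod.fst ?_ ?_
  · intro p hp
    simp only [Finset.coe_filter, Finset.mem_product, Set.mem_ofPred_eq] at hp
    exact hp.1.1
  · intro p hp p' hp' h
    simp only [Finset.coe_filter, Finset.mem_product, Set.mem_ofPred_eq] at hp hp'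
    ext
    · exact h
    · omega

open scoped Pointwise in
theorem sum_pairsCard (A : Finset ℕ) : ∑ z ∈ A + A, pairsCard A z = A.card ^ 2 := by
  rw [sq, ← Finset.card_product]
  refine (Finset.card_eq_sum_card_fiberwise fun p hp => ?_).symm
  simp only [Finset.coe_product, Set.mem_prod, Finset.mem_coe] at hp
  exact Finset.add_mem_add hp.1 hp.2

open scoped Pointwise in
theorem exists_popular_sums_s8 {A : Finset ℕ} (hA : A.Nonempty) :
    ∃ (w : ℕ) (B : Finset ℕ), B ⊆ A + A ∧ (∀ z ∈ B, w ≤ pairsCard A z) ∧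
      A.card ≤ 2 * B.card ∧
      (A.card : ℝ) ^ 2 ≤ 2 * Real.logb 2 (2 * A.card) * (w * B.card) := by
  have hN : 0 < A.card := hA.card_pos
  have hH := sum_Icc_inv_le_logb_two_mul hN
  have hsum := sum_Icc_card_filter_le (A + A) (pairsCard A) fun z _ => pairsCard_le_card A z
  rw [sum_pairsCard] at hsum
  set N := A.card with hNdef
  set L := Real.logb 2 (2 * N)
  have hN' : (0 : ℝ) < N := by exact_mod_cast hN
  have hL : 0 < L := Real.logb_pos (by norm_num) (by
    have : (1 : ℝ) ≤ N := by exact_mod_cast hN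
    linarith)
  by_contra! hcon
  have hlt : ∀ w ∈ Finset.Icc 1 N, (((A + A).filter (w ≤ pairsCard A ·)).card : ℝ) <
      N / 2 + N ^ 2 / (2 * L) * (w : ℝ)⁻¹ := by
    intro w hw
    have hw0 : (0 : ℝ) < w := by exact_mod_cast (Finset.mem_Icc.1 hw).1
    have h1 := hcon w ((A + A).filter (w ≤ pairsCard A ·)) (Finset.filter_subset _ _)
      fun z hz => (Finset.mem_filter.1 hz).2
    have hpos : 0 < (N : ℝ) ^ 2 / (2 * L) * (w : ℝ)⁻¹ := by positivity
    generalize ((A + A).filter (w ≤ pairsCard A ·)).card = b at h1 ⊢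
    rcases lt_or_ge (2 * b) N with h | h
    · have : (2 * b : ℝ) < N := by exact_mod_cast h
      linarith
    · have h2 := h1 h
      have h3 : (b : ℝ) < N ^ 2 / (2 * L) * (w : ℝ)⁻¹ := by
        rw [div_mul_eq_mul_div, lt_div_iff₀ (by positivity), ← div_eq_mul_inv, lt_div_iff₀ hw0]
        linarith
      linarith
  have h4 := Finset.sum_lt_sum_of_nonempty ⟨1, Finset.mem_Icc.2 ⟨le_rfl, hN⟩⟩ hlt
  rw [Finset.sum_add_distrib, ← Finset.mul_sum, ← Nat.cast_sum, hsum] at h4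
  simp only [Finset.sum_const, Nat.card_Icc, Nat.add_sub_cancel, nsmul_eq_mul] at h4
  push_cast at h4
  have h5 : (N : ℝ) ^ 2 / (2 * L) * ∑ w ∈ Finset.Icc 1 N, (w : ℝ)⁻¹ ≤ N ^ 2 / 2 := by
    calc _ ≤ (N : ℝ) ^ 2 / (2 * L) * L := by gcongr
      _ = N ^ 2 / 2 := by field_simp
  nlinarith

theorem exists_pair_of_mul_lt {A : Finset ℕ} {u t w z : ℕ} {Y : Multiset ℕ}
    (hY : ∀ x ∈ Y, x ∈ A) (ht : card Y = 2 * t) (hz : w ≤ pairsCard A z)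
    (hw : 8 * t + 1 < w * u) :
    ∃ x ∈ A, ∃ y ∈ A, x + y = z ∧ 2 * Y.count x < u ∧ 2 * Y.count y < u ∧
      (x = y → u ≠ 1) := by
  set bad := A.filter fun x => u ≤ 2 * Y.count x with hbad
  set E : Finset (ℕ × ℕ) := bad.image (fun x => (x, z - x)) ∪ bad.image (fun x => (z - x, x)) ∪
    (if u = 1 then {(z / 2, z / 2)} else ∅) with hE
  have hbadcard : u * bad.card ≤ 4 * t := by
    calc u * bad.card = ∑ x ∈ bad, u := by simp [mul_comm]
      _ ≤ ∑ x ∈ bad, 2 * Y.count x :=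
        Finset.sum_le_sum fun x hx => (Finset.mem_filter.1 hx).2
      _ ≤ ∑ x ∈ A, 2 * Y.count x :=
        Finset.sum_le_sum_of_subset (Finset.filter_subset _ _)
      _ = 4 * t := by
        rw [← Finset.mul_sum, Multiset.sum_count_eq_card hY, ht]
        ring
  have hEcard : u * E.card ≤ 8 * t + 1 := by
    have h1 : E.card ≤ bad.card + bad.card + (if u = 1 then 1 else 0) := by
      refine (Finset.card_union_le _ _).trans (Nat.add_le_add
        ((Finset.card_union_le _ _).trans
          (Nat.add_le_add Finset.card_image_le Finset.card_image_le)) ?_)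
      split_ifs <;> simp
    have h2 := Nat.mul_le_mul_left u h1
    have h3 : u * (if u = 1 then 1 else 0) ≤ 1 := by split_ifs with h <;> simp [h]
    rw [mul_add, mul_add] at h2
    omega
  have hlt : E.card < ((A ×ˢ A).filter fun p => p.1 + p.2 = z).card := by
    refine lt_of_lt_of_le ?_ hz
    by_contra! h
    have := Nat.mul_le_mul_left u h
    rw [mul_comm w] at hw
    omega
  obtain ⟨⟨x, y⟩, hp, hpE⟩ := Finset.exists_mem_notMem_of_card_lt_card hlt
  simp only [Finset.mem_filter, Finset.mem_product] at hp
  obtain ⟨⟨hx, hy⟩, hxy⟩ := hp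
  simp only [hE, Finset.mem_union, not_or, Finset.mem_image, not_exists, not_and,
    Prod.mk.injEq] at hpE
  obtain ⟨⟨h1, h2⟩, h3⟩ := hpE
  refine ⟨x, hx, y, hy, hxy, ?_, ?_, ?_⟩
  · by_contra! h
    exact h1 x (Finset.mem_filter.2 ⟨hx, h⟩) rfl (by omega)
  · by_contra! h
    exact h2 y (Finset.mem_filter.2 ⟨hy, h⟩) (by omega) rfl
  · intro hxy' hu1
    apply h3
    rw [if_pos hu1, Finset.mem_singleton, Prod.mk.injEq]
    omega

theorem exists_multiset_sum_eq_of_popular {A : Finset ℕ} {u w : ℕ}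
    (T : Multiset ℕ) (hT : ∀ z ∈ T, w ≤ pairsCard A z) (hc : 8 * card T ≤ w * u) :
    ∃ Y : Multiset ℕ, (∀ x ∈ Y, x ∈ A) ∧ (∀ x, Y.count x ≤ u) ∧ Y.sum = T.sum ∧
      card Y = 2 * card T := by
  induction T using Multiset.induction_on with
  | empty => exact ⟨0, by simp⟩
  | cons z T ih =>
    rw [Multiset.card_cons] at hc
    obtain ⟨Y, hYA, hYu, hYs, hYc⟩ := ih (fun z hz => hT z (Multiset.mem_cons_of_mem hz)) (by omega)
    obtain ⟨x, hx, y, hy, hxy, h1, h2, h3⟩ := exists_pair_of_mul_lt (u := u) hYA hYc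
      (hT z (Multiset.mem_cons_self z T)) (by omega)
    refine ⟨x ::ₘ y ::ₘ Y, ?_, ?_, ?_, ?_⟩
    · intro a ha
      rcases Multiset.mem_cons.1 ha with rfl | ha
      · exact hx
      rcases Multiset.mem_cons.1 ha with rfl | ha
      · exact hy
      · exact hYA a ha
    · intro a
      have := hYu a
      simp only [Multiset.count_cons]
      split_ifs with ha hb hb
      · subst ha; subst hb
        have := h3 rfl
        omega
      · subst ha; omega
      · subst hb; omega
      · omega
    · rw [Multiset.sum_cons, Multiset.sum_cons, Multiset.sum_cons, hYs]
      omega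
    · simp only [Multiset.card_cons]
      omega

theorem exists_mul_card_le_count (X : Multiset ℕ) (hX : X ≠ 0) :
    ∃ u : ℕ, 0 < u ∧ u ≤ maxMul X ∧
      (card X : ℝ) ≤
        Real.logb 2 (2 * maxMul X) * (u * (X.toFinset.filter (u ≤ X.count ·)).card) := by
  have hle : ∀ x ∈ X.toFinset, X.count x ≤ maxMul X := fun x hx =>
    Finset.le_sup (f := fun x => X.count x) hx
  obtain ⟨x₀, hx₀⟩ := Multiset.exists_mem_of_ne_zero hX
  have hM : 0 < maxMul X :=
    (Multiset.count_pos.2 hx₀).trans_le (hle x₀ (Multiset.mem_toFinset.2 hx₀))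
  have hsum := sum_Icc_card_filter_le X.toFinset (fun x => X.count x) hle
  rw [Multiset.toFinset_sum_count_eq] at hsum
  have hH := sum_Icc_inv_le_logb_two_mul hM
  set L := Real.logb 2 (2 * maxMul X)
  have hL : 0 < L := Real.logb_pos (by norm_num) (by
    have : (1 : ℝ) ≤ maxMul X := by exact_mod_cast hM
    linarith)
  by_contra! hcon
  have hlt : ∀ u ∈ Finset.Icc 1 (maxMul X),
      ((X.toFinset.filter (u ≤ X.count ·)).card : ℝ) < card X / L * (u : ℝ)⁻¹ := by
    intro u hu
    rw [Finset.mem_Icc] at hu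
    have hu0 : (0 : ℝ) < u := by exact_mod_cast hu.1
    have := hcon u hu.1 hu.2
    rw [div_mul_eq_mul_div, lt_div_iff₀ hL, ← div_eq_mul_inv, lt_div_iff₀ hu0]
    linarith
  have h4 := Finset.sum_lt_sum_of_nonempty ⟨1, Finset.mem_Icc.2 ⟨le_rfl, hM⟩⟩ hlt
  rw [← Finset.mul_sum, ← Nat.cast_sum, hsum] at h4
  have h5 : (card X : ℝ) / L * ∑ w ∈ Finset.Icc 1 (maxMul X), (w : ℝ)⁻¹ ≤ card X := by
    calc _ ≤ (card X : ℝ) / L * L := by gcongr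
      _ = card X := by field_simp
  linarith

theorem stmt8 (X : Multiset ℕ) (hX : X ≠ 0) (hpos : ∀ x ∈ X, 0 < x)
    (n : ℕ) (hn : n = Multiset.card X)
    (m : ℕ) (hm1 : 2 * mxElt X ≤ m)
    (hm2 : (m : ℝ) ≤ (n : ℝ) ^ 2 /
      (33984 * maxMul X * Real.logb 2 (2 * n) * (Real.logb 2 (2 * maxMul X)) ^ 2)) :
    ∃ a s : ℕ, 0 < s ∧
      (s : ℝ) ≤ 4248 * maxMul X * mxElt X * Real.logb 2 (2 * maxMul X) / n ∧
      (∀ i : ℕ, 1 ≤ i → i ≤ m →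
        ∃ Y ≤ X, Y.sum = a + i * s ∧
          (Multiset.card Y : ℝ) ≤ 4248 * m * maxMul X * Real.logb 2 (2 * maxMul X) / n) ∧
      ((a + m * s : ℕ) : ℝ) ≤ 4248 * m * maxMul X * mxElt X * Real.logb 2 (2 * maxMul X) / n := by
  subst hn
  obtain ⟨u, hu0, huμ, hcard⟩ := exists_mul_card_le_count X hX
  set A := X.toFinset.filter (u ≤ X.count ·) with hA
  have hle : ∀ x ∈ X, x ≤ mxElt X := fun x hx => Multiset.le_sup hx
  have hn0 : 0 < card X := Multiset.card_pos.2 hX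
  have hn0' : (0 : ℝ) < card X := by exact_mod_cast hn0
  have hAX : ∀ x ∈ A, x ∈ X := fun x hx => Multiset.mem_toFinset.1 (Finset.mem_filter.1 hx).1
  have hAne : A.Nonempty := by
    rw [Finset.nonempty_iff_ne_empty]
    intro h
    rw [h] at hcard
    simp at hcard
    exact hX hcard
  obtain ⟨w, B, hBA, hBw, hBcard, hwB⟩ := exists_popular_sums_s8 hAne
  have hb0 : 0 < B.card := by
    have := hAne.card_pos
    omega
  have hBl : ∀ z ∈ B, 0 < z ∧ z ≤ 2 * mxElt X := by
    intro z hz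
    obtain ⟨x, hx, y, hy, rfl⟩ := Finset.mem_add.1 (hBA hz)
    have := hpos x (hAX x hx)
    have := hle x (hAX x hx)
    have := hle y (hAX y hy)
    omega
  obtain ⟨a, s, hs0, hsB, hT⟩ :=
    exists_arithmetic_progression_multiset_sums (Finset.card_pos.1 hb0) hBl hm1
  have hμ : (1 : ℝ) ≤ maxMul X := by exact_mod_cast hu0.trans_le huμ
  have hL : 0 < Real.logb 2 (2 * maxMul X) := Real.logb_pos (by norm_num) (by linarith)
  have hn1 : (1 : ℝ) ≤ card X := by exact_mod_cast hn0
  have hΛ : 0 < Real.logb 2 (2 * card X) := Real.logb_pos (by norm_num) (by linarith)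
  have hN1 : (1 : ℝ) ≤ A.card := by exact_mod_cast hAne.card_pos
  have hNn : (A.card : ℝ) ≤ card X := by
    exact_mod_cast (Finset.card_filter_le _ _).trans (Multiset.toFinset_card_le X)
  have hΛN : Real.logb 2 (2 * A.card) ≤ Real.logb 2 (2 * card X) :=
    Real.logb_le_logb_of_le (by norm_num) (by linarith) (by linarith)
  have huμ' : (u : ℝ) ≤ maxMul X := by exact_mod_cast huμ
  have hu0' : (0 : ℝ) < u := by exact_mod_cast hu0
  have hBcard' : (A.card : ℝ) ≤ 2 * B.card := by exact_mod_cast hBcard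
  rw [le_div_iff₀ (by positivity)] at hm2
  generalize Real.logb 2 (2 * card X) = Λ at *
  generalize Real.logb 2 (2 * A.card) = Λ' at *
  generalize Real.logb 2 (2 * maxMul X) = L at *
  generalize hμX : (maxMul X : ℝ) = μ at *
  generalize (card X : ℝ) = n at *
  -- the bucket `B` is popular enough
  have hmain : 56 * m ≤ w * u * B.card := by
    have h1 : n ^ 2 ≤ L ^ 2 * μ * (u * (A.card : ℝ) ^ 2) := by
      calc n ^ 2 ≤ (L * (u * A.card)) ^ 2 := by gcongr
        _ = L ^ 2 * u * (u * (A.card : ℝ) ^ 2) := by ring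
        _ ≤ L ^ 2 * μ * (u * (A.card : ℝ) ^ 2) := by gcongr
    have h2 : (A.card : ℝ) ^ 2 ≤ 2 * Λ * (w * B.card) := hwB.trans (by gcongr)
    have h3 : (L ^ 2 * μ * Λ) * (33984 * m) ≤ (L ^ 2 * μ * Λ) * (2 * (w * u * B.card)) := by
      calc (L ^ 2 * μ * Λ) * (33984 * m) = m * (33984 * μ * Λ * L ^ 2) := by ring
        _ ≤ L ^ 2 * μ * (u * (A.card : ℝ) ^ 2) := hm2.trans h1
        _ ≤ L ^ 2 * μ * (u * (2 * Λ * (w * B.card))) := by gcongr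
        _ = _ := by ring
    have h4 := le_of_mul_le_mul_left h3 (by positivity)
    have h5 : 33984 * m ≤ 2 * (w * u * B.card) := by exact_mod_cast h4
    omega
  have hnB : n ≤ L * μ * (2 * B.card) := by
    calc n ≤ L * (u * A.card) := hcard
      _ ≤ L * (μ * (2 * B.card)) := by gcongr
      _ = _ := by ring
  have hrep : ∀ i : ℕ, i ≤ m → ∃ Y ≤ X, Y.sum = a + i * s ∧
      (card Y : ℝ) * n ≤ 28 * (m * μ * L) := by
    intro i hi
    obtain ⟨T, hTB, hTs, hTc⟩ := hT i hi
    have h8 : 8 * card T ≤ w * u := by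
      refine Nat.le_of_mul_le_mul_right ?_ hb0
      linarith
    obtain ⟨Y, hYA, hYu, hYs, hYc⟩ :=
      exists_multiset_sum_eq_of_popular T (fun z hz => hBw z (hTB z hz)) h8
    refine ⟨Y, ?_, hYs.trans hTs, ?_⟩
    · rw [Multiset.le_iff_count]
      intro x
      by_cases hx : x ∈ Y
      · exact (hYu x).trans (Finset.mem_filter.1 (hYA x hx)).2
      · simp [Multiset.count_eq_zero_of_notMem hx]
    · have hTc' : (card T : ℝ) * B.card ≤ 7 * m := by exact_mod_cast hTc
      rw [hYc]
      push_cast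
      calc (2 * card T : ℝ) * n ≤ 2 * card T * (L * μ * (2 * B.card)) := by gcongr
        _ = 4 * L * μ * (card T * B.card) := by ring
        _ ≤ 4 * L * μ * (7 * m) := by gcongr
        _ = _ := by ring
  refine ⟨a, s, hs0, ?_, fun i _ hi => ?_, ?_⟩
  · rw [le_div_iff₀ hn0']
    have hsB' : (s : ℝ) * B.card ≤ 2 * mxElt X := by exact_mod_cast hsB
    have : 0 ≤ μ * mxElt X * L := by positivity
    calc (s : ℝ) * n ≤ s * (L * μ * (2 * B.card)) := by gcongr
      _ = 2 * L * μ * (s * B.card) := by ring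
      _ ≤ 2 * L * μ * (2 * mxElt X) := by gcongr
      _ ≤ 4248 * μ * mxElt X * L := by linarith
  · obtain ⟨Y, hYX, hYs, hYc⟩ := hrep i hi
    refine ⟨Y, hYX, hYs, ?_⟩
    have : 0 ≤ m * μ * L := by positivity
    rw [le_div_iff₀ hn0']
    linarith
  · obtain ⟨Y, hYX, hYs, hYc⟩ := hrep m le_rfl
    have hsum := Multiset.sum_le_card_nsmul Y (mxElt X) fun x hx =>
      hle x (Multiset.mem_of_le hYX hx)
    have hsum' : ((Y.sum : ℕ) : ℝ) ≤ card Y * mxElt X := by exact_mod_cast hsum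
    have : 0 ≤ m * μ * L * mxElt X := by positivity
    rw [le_div_iff₀ hn0', ← hYs]
    calc ((Y.sum : ℕ) : ℝ) * n ≤ card Y * mxElt X * n := by gcongr
      _ = card Y * n * mxElt X := by ring
      _ ≤ 28 * (m * μ * L) * mxElt X := by gcongr
      _ ≤ 4248 * m * μ * mxElt X * L := by linarith
end

section
/- Let X ⊆ {1, …, m} be a set of n positive integers. Then the set X^{≤ 354m/n} := ⋃_{j=1}^{⌊354m/n⌋} X^j, where X^j denotes the j-fold sumset of X, contains an arithmetic progression of length m. -/
open Multiset

open scoped Pointwise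

/-- An integer multiple of `|B + A| - (1 - |A| / (2|G|)) |B|`, the expansion of `B` by `A`. -/
def expansion {G : Type*} [AddCommGroup G] [Fintype G] [DecidableEq G] (A B : Finset G) : ℤ :=
  2 * Fintype.card G * (B + A).card - (2 * Fintype.card G - A.card) * B.card

section Expansion

variable {G : Type*} [AddCommGroup G] [Fintype G] [DecidableEq G] {A : Finset G}

theorem expansion_vadd_finset (x : G) (B : Finset G) : expansion A (x +ᵥ B) = expansion A B := by
  simp [expansion, vadd_add_assoc, Finset.card_vadd_finset]

theorem expansion_inter_add_expansion_union_le (B C : Finset G) :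
    expansion A (B ∩ C) + expansion A (B ∪ C) ≤ expansion A B + expansion A C := by
  have h1 := Finset.card_inter_add_card_union B C
  have h2 := Finset.card_inter_add_card_union (B + A) (C + A)
  have h3 : ((B ∩ C) + A).card ≤ ((B + A) ∩ (C + A)).card :=
    Finset.card_le_card Finset.inter_add_subset
  rw [← Finset.union_add] at h2
  unfold expansion
  zify at h1 h2 h3
  have h4 : (((B ∩ C) + A).card : ℤ) + ((B ∪ C) + A).card ≤ (B + A).card + (C + A).card := by
    linarith
  have h5 := mul_le_mul_of_nonneg_left h4 (by positivity : (0 : ℤ) ≤ 2 * Fintype.card G)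
  linear_combination h5 - (2 * Fintype.card G - A.card : ℤ) * h1

/-- The expansion is minimized over nonempty sets by some subgroup. -/
theorem exists_addSubgroup_expansion_le (A : Finset G) :
    ∃ (H : AddSubgroup G) (F : Finset G), (F : Set G) = H ∧
      ∀ B : Finset G, B.Nonempty → expansion A F ≤ expansion A B := by
  obtain ⟨F₀, hF₀, hmin₀⟩ := Finset.exists_min_image
    (Finset.univ.filter fun B : Finset G => B.Nonempty) (expansion A) ⟨{0}, by simp⟩
  obtain ⟨F₁, hF₁, hmin₁⟩ := Finset.exists_min_image
    (Finset.univ.filter fun B : Finset G => B.Nonempty ∧ expansion A B = expansion A F₀)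
    Finset.card ⟨F₀, by simpa using hF₀⟩
  simp only [Finset.mem_filter, Finset.mem_univ, true_and, and_imp] at hF₀ hmin₀ hF₁ hmin₁
  obtain ⟨⟨y, hy⟩, hF₁e⟩ := hF₁
  set F : Finset G := -y +ᵥ F₁ with hF
  have hFe : expansion A F = expansion A F₀ := by rw [hF, expansion_vadd_finset, hF₁e]
  have h0 : (0 : G) ∈ F := Finset.mem_vadd_finset.2 ⟨y, hy, by simp⟩
  have hmin (B : Finset G) (hB : B.Nonempty) (he : expansion A B = expansion A F₀) :
      F.card ≤ B.card := by
    rw [hF, Finset.card_vadd_finset]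
    exact hmin₁ B hB he
  have htrans (x : G) (hx : x ∈ F) : x +ᵥ F = F := by
    have hxF : x ∈ x +ᵥ F := Finset.mem_vadd_finset.2 ⟨0, h0, by simp⟩
    have hne : (F ∩ (x +ᵥ F)).Nonempty := ⟨x, Finset.mem_inter.2 ⟨hx, hxF⟩⟩
    have h1 := expansion_inter_add_expansion_union_le (A := A) F (x +ᵥ F)
    rw [expansion_vadd_finset x F, hFe] at h1
    have h2 := hmin₀ _ hne
    have h3 := hmin₀ (F ∪ (x +ᵥ F)) ⟨x, Finset.mem_union_left _ hx⟩
    have h4 := hmin _ hne (by linarith)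
    have h5 := Finset.eq_of_subset_of_card_le Finset.inter_subset_left h4
    exact (Finset.eq_of_subset_of_card_le (Finset.inter_eq_left.1 h5)
      (Finset.card_vadd_finset _ _).le).symm
  refine ⟨{ carrier := F, zero_mem' := h0, add_mem' := ?_, neg_mem' := ?_ }, F, rfl, ?_⟩
  · intro a b ha hb
    rw [Finset.mem_coe, ← htrans a ha]
    exact Finset.mem_vadd_finset.2 ⟨b, hb, rfl⟩
  · intro a ha
    have h := h0
    rw [← htrans a ha] at h
    obtain ⟨b, hb, hab⟩ := Finset.mem_vadd_finset.1 h
    rw [vadd_eq_add] at hab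
    rwa [neg_eq_of_add_eq_zero_right hab]
  · intro B hB
    rw [hFe]
    exact hmin₀ B hB

/-- Expansion of sets by a generating set containing zero. -/
theorem card_mul_card_le_expansion_s9 (h0 : (0 : G) ∈ A)
    (hA : AddSubgroup.closure (A : Set G) = ⊤) (B : Finset G) (hB : B.Nonempty) :
    (Fintype.card G * A.card : ℤ) ≤ expansion A B := by
  obtain ⟨H, F, hFH, hmin⟩ := exists_addSubgroup_expansion_le A
  refine le_trans ?_ (hmin B hB)
  have hmem (x : G) : x ∈ F ↔ x ∈ H := by rw [← Finset.mem_coe, hFH, SetLike.mem_coe]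
  by_cases hAH : A ⊆ F
  · have hH : H = ⊤ := by
      rw [eq_top_iff, ← hA, AddSubgroup.closure_le, ← hFH]
      exact_mod_cast hAH
    have hF : F = Finset.univ := by ext x; simp [hmem, hH]
    have h1 : Finset.univ + A = Finset.univ :=
      Finset.eq_univ_of_forall fun x => Finset.mem_add.2 ⟨x, Finset.mem_univ _, 0, h0, add_zero x⟩
    rw [expansion, hF, h1, Finset.card_univ]
    apply le_of_eq
    ring
  · obtain ⟨a, haA, haF⟩ := Finset.not_subset.1 hAH
    have hsub : F ∪ (a +ᵥ F) ⊆ F + A := by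
      intro x hx
      rcases Finset.mem_union.1 hx with hx | hx
      · exact Finset.mem_add.2 ⟨x, hx, 0, h0, add_zero x⟩
      · obtain ⟨b, hb, rfl⟩ := Finset.mem_vadd_finset.1 hx
        exact Finset.mem_add.2 ⟨b, hb, a, haA, add_comm _ _⟩
    have hdisj : Disjoint F (a +ᵥ F) := by
      rw [Finset.disjoint_left]
      intro x hx hx'
      obtain ⟨b, hb, rfl⟩ := Finset.mem_vadd_finset.1 hx'
      rw [hmem] at hx hb haF
      exact haF ((H.add_mem_cancel_right hb).1 hx)
    have h1 := Finset.card_le_card hsub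
    rw [Finset.card_union_of_disjoint hdisj, Finset.card_vadd_finset] at h1
    have h2 : A.card ≤ (F + A).card := Finset.card_le_card fun x hx =>
      Finset.mem_add.2 ⟨0, (hmem 0).2 H.zero_mem, x, hx, zero_add x⟩
    unfold expansion
    zify at h1 h2
    have h3 : (0 : ℤ) ≤ Fintype.card G := by positivity
    have h4 : (0 : ℤ) ≤ A.card * F.card := by positivity
    nlinarith

theorem card_lt_two_mul_card_nsmul (h0 : (0 : G) ∈ A)
    (hA : AddSubgroup.closure (A : Set G) = ⊤) (j : ℕ) :
    Fintype.card G < 2 * (j • A).card ∨ j * A.card ≤ 4 * (j • A).card := by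
  induction j with
  | zero => simp
  | succ j ih =>
    have hne : (j • A).Nonempty := (show A.Nonempty from ⟨0, h0⟩).nsmul
    have hmono : (j • A).card ≤ ((j + 1) • A).card := by
      rw [succ_nsmul]
      exact Finset.card_le_card fun x hx => Finset.mem_add.2 ⟨x, hx, 0, h0, add_zero x⟩
    by_cases hbig : Fintype.card G < 2 * (j • A).card
    · left; omega
    · right
      have hexp := card_mul_card_le_expansion_s9 h0 hA (j • A) hne
      rw [expansion, ← succ_nsmul] at hexp
      have ih' := ih.resolve_left hbig
      have hG : 0 < Fintype.card G := Fintype.card_pos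
      zify at *
      push Not at hbig
      have h1 : (A.card : ℤ) * (2 * (j • A).card) ≤ A.card * Fintype.card G :=
        mul_le_mul_of_nonneg_left hbig (by positivity)
      have h2 : (Fintype.card G : ℤ) * (4 * (j • A).card + A.card) ≤
          Fintype.card G * (4 * ((j + 1) • A).card) := by linarith
      have h3 := le_of_mul_le_mul_left h2 hG
      linarith

/-- Diameter bound for directed Cayley graphs of finite abelian groups. -/
theorem exists_nsmul_eq_univ (h0 : (0 : G) ∈ A)
    (hA : AddSubgroup.closure (A : Set G) = ⊤) :
    ∃ h : ℕ, h * A.card ≤ 6 * Fintype.card G ∧ h • A = Finset.univ := by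
  have hpos : 0 < A.card := Finset.card_pos.2 ⟨0, h0⟩
  set j := 2 * Fintype.card G / A.card + 1 with hj
  have hj1 : j * A.card ≤ 3 * Fintype.card G := by
    have := Nat.div_mul_le_self (2 * Fintype.card G) A.card
    have := Finset.card_le_univ A
    rw [hj, add_mul]
    omega
  have hj2 : 2 * Fintype.card G < j * A.card := by
    rw [hj, mul_comm _ A.card]
    exact Nat.lt_mul_div_succ _ hpos
  have hbig : Fintype.card G < 2 * (j • A).card := by
    rcases card_lt_two_mul_card_nsmul h0 hA j with h | h <;> omega
  refine ⟨j + j, by rw [add_mul]; omega, Finset.eq_univ_of_forall fun x => ?_⟩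
  rw [add_nsmul]
  by_contra hx
  have hdisj : Disjoint (j • A) ((j • A).image fun y => x - y) := by
    rw [Finset.disjoint_left]
    intro z hz hz'
    obtain ⟨y, hy, rfl⟩ := Finset.mem_image.1 hz'
    exact hx (Finset.mem_add.2 ⟨_, hz, y, hy, sub_add_cancel x y⟩)
  have h1 := Finset.card_le_univ (j • A ∪ (j • A).image fun y => x - y)
  rw [Finset.card_union_of_disjoint hdisj,
    Finset.card_image_of_injective _ sub_right_injective] at h1
  omega

end Expansion

theorem exists_multiset_of_mem_nsmul_image_s9 {M : Type*} [AddCommMonoidWithOne M] [DecidableEq M]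
    (X : Finset ℕ) (h : ℕ) (y : M) (hy : y ∈ h • X.image (Nat.cast : ℕ → M)) :
    ∃ Y : Multiset ℕ, (∀ x ∈ Y, x ∈ X) ∧ Multiset.card Y = h ∧ (Y.sum : M) = y := by
  induction h generalizing y with
  | zero => exact ⟨0, by simpa [eq_comm] using hy⟩
  | succ h ih =>
    rw [succ_nsmul] at hy
    obtain ⟨u, hu, v, hv, rfl⟩ := Finset.mem_add.1 hy
    obtain ⟨Y, hY, hc, hs⟩ := ih u hu
    obtain ⟨x, hx, rfl⟩ := Finset.mem_image.1 hv
    refine ⟨x ::ₘ Y, ?_, by simp [hc], by simp [hs, add_comm]⟩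
    intro z hz
    rcases Multiset.mem_cons.1 hz with rfl | hz
    exacts [hx, hY z hz]

theorem closure_image_natCast_zmod_eq_top (L : ℕ) (X : Finset ℕ)
    (hgcd : ∀ d : ℕ, (∀ x ∈ X, d ∣ x) → d = 1) :
    AddSubgroup.closure ((X.image (Nat.cast : ℕ → ZMod L) : Finset (ZMod L)) : Set (ZMod L)) =
      ⊤ := by
  set S := AddSubgroup.closure
    ((X.image (Nat.cast : ℕ → ZMod L) : Finset (ZMod L)) : Set (ZMod L)) with hS
  obtain ⟨g, hg⟩ := Int.subgroup_cyclic (S.comap (Int.castAddHom (ZMod L)))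
  rw [← AddSubgroup.zmultiples_eq_closure] at hg
  have hg1 : g.natAbs = 1 := by
    refine hgcd _ fun x hx => ?_
    have hxS : (x : ℤ) ∈ S.comap (Int.castAddHom (ZMod L)) := by
      rw [AddSubgroup.mem_comap]
      refine AddSubgroup.subset_closure ?_
      simpa using ⟨x, hx, rfl⟩
    rw [hg, Int.mem_zmultiples_iff] at hxS
    exact Int.natCast_dvd_natCast.1 (Int.natAbs_dvd.2 hxS)
  refine eq_top_iff.2 fun z _ => ?_
  obtain ⟨k, rfl⟩ := ZMod.intCast_surjective z
  have hk : k ∈ S.comap (Int.castAddHom (ZMod L)) := by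
    rw [hg, Int.mem_zmultiples_iff]
    exact (Int.isUnit_iff_natAbs_eq.2 hg1).dvd
  simpa using hk

theorem exists_interval_subset_sumsets (m L : ℕ) (X : Finset ℕ) (hX : X ⊆ Finset.Icc 1 L)
    (hL : L ∈ X) (hLm : L ≤ m) (hgcd : ∀ d : ℕ, (∀ x ∈ X, d ∣ x) → d = 1) :
    ∃ a : ℕ, ∀ i : ℕ, 1 ≤ i → i ≤ m → ∃ Y : Multiset ℕ, (∀ y ∈ Y, y ∈ X) ∧
      1 ≤ Multiset.card Y ∧ Multiset.card Y * X.card ≤ 13 * m ∧ Y.sum = a + i := by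
  have hL0 : 1 ≤ L := (Finset.mem_Icc.1 (hX hL)).1
  have : NeZero L := ⟨by omega⟩
  have hcardA : (X.image (Nat.cast : ℕ → ZMod L)).card = X.card := by
    refine Finset.card_image_of_injOn fun x hx y hy hxy => ?_
    have hx' := Finset.mem_Icc.1 (hX hx)
    have hy' := Finset.mem_Icc.1 (hX hy)
    have hmod : x - 1 ≡ y - 1 [MOD L] := by
      refine Nat.ModEq.add_right_cancel' 1 ?_
      rw [Nat.sub_add_cancel hx'.1, Nat.sub_add_cancel hy'.1]
      exact (ZMod.natCast_eq_natCast_iff x y L).1 hxy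
    have := hmod.eq_of_lt_of_lt (by omega) (by omega)
    omega
  obtain ⟨h, hh, huniv⟩ := exists_nsmul_eq_univ
    (A := X.image (Nat.cast : ℕ → ZMod L)) (Finset.mem_image.2 ⟨L, hL, by simp⟩)
    (closure_image_natCast_zmod_eq_top L X hgcd)
  rw [hcardA, ZMod.card] at hh
  have hXL : X.card ≤ L := by simpa using Finset.card_le_card hX
  refine ⟨h * L, fun i hi him => ?_⟩
  obtain ⟨Y, hYX, hYc, hYs⟩ := exists_multiset_of_mem_nsmul_image_s9 X h ((h * L + i : ℕ) : ZMod L)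
    (by rw [huniv]; exact Finset.mem_univ _)
  have hle : Y.sum ≤ h * L := by
    rw [← hYc, ← smul_eq_mul]
    exact Multiset.sum_le_card_nsmul Y L fun x hx => (Finset.mem_Icc.1 (hX (hYX x hx))).2
  have hmod := (ZMod.natCast_eq_natCast_iff _ _ L).1 hYs
  obtain ⟨u, hu⟩ := (Nat.modEq_iff_dvd' (by omega)).1 hmod
  have hsum : Y.sum + L * u = h * L + i := by omega
  refine ⟨Y + Multiset.replicate u L, ?_, ?_, ?_, ?_⟩
  · intro y hy
    rcases Multiset.mem_add.1 hy with hy | hy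
    · exact hYX y hy
    · rw [Multiset.eq_of_mem_replicate hy]
      exact hL
  · rw [Nat.one_le_iff_ne_zero, Ne, Multiset.card_eq_zero]
    intro h0
    have := congrArg Multiset.sum h0
    simp only [Multiset.sum_add, Multiset.sum_replicate, smul_eq_mul, Multiset.sum_zero] at this
    rw [mul_comm u] at this
    omega
  · rw [Multiset.card_add, Multiset.card_replicate, hYc]
    have h1 : (h + u) * X.card * L ≤ 13 * m * L := by
      have h2 : u * L ≤ h * L + i := by rw [mul_comm u]; omega
      calc (h + u) * X.card * L = h * X.card * L + u * L * X.card := by ring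
        _ ≤ h * X.card * L + (h * L + i) * X.card := by gcongr
        _ = 2 * (h * X.card) * L + i * X.card := by ring
        _ ≤ 2 * (6 * L) * L + m * L := by gcongr
        _ ≤ 2 * (6 * m) * L + m * L := by gcongr
        _ = 13 * m * L := by ring
    exact Nat.le_of_mul_le_mul_right h1 hL0
  · rw [Multiset.sum_add, Multiset.sum_replicate, smul_eq_mul, mul_comm u, hsum]

theorem stmt9 (m n : ℕ) (hm : 1 ≤ m) (X : Finset ℕ) (hXne : X.Nonempty)
    (hX : X ⊆ Finset.Icc 1 m) (hn : n = X.card) :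
    ∃ a s : ℕ, 0 < s ∧ ∀ i : ℕ, 1 ≤ i → i ≤ m →
      ∃ j : ℕ, 1 ≤ j ∧ (j : ℝ) ≤ 354 * m / n ∧
        ∃ Y : Multiset ℕ, (∀ y ∈ Y, y ∈ X) ∧ Multiset.card Y = j ∧ Y.sum = a + i * s := by
  obtain ⟨X', hX', hgcd⟩ := Finset.extract_gcd (id : ℕ → ℕ) hXne
  set d := X.gcd id with hd
  simp only [id] at hX'
  have hdpos : 0 < d := by
    obtain ⟨x, hx⟩ := hXne
    have := (Finset.mem_Icc.1 (hX hx)).1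
    exact Nat.pos_of_ne_zero fun h => by have := hX' x hx; simp [h] at this; omega
  have hinj : Set.InjOn X' X := fun x hx y hy hxy => by rw [hX' x hx, hX' y hy, hxy]
  have hpos (x : ℕ) (hx : x ∈ X) : 1 ≤ X' x := by
    have := (Finset.mem_Icc.1 (hX hx)).1
    exact Nat.pos_of_ne_zero fun h => by have := hX' x hx; simp [h] at this; omega
  have hcard : (X.image X').card = n := by rw [Finset.card_image_of_injOn hinj, hn]
  have hne : (X.image X').Nonempty := hXne.image X'
  have hLmem := Finset.max'_mem _ hne
  obtain ⟨M, hM, hML⟩ := Finset.mem_image.1 hLmem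
  obtain ⟨a, ha⟩ := exists_interval_subset_sumsets m ((X.image X').max' hne) (X.image X')
    (fun x hx => Finset.mem_Icc.2 ⟨by
      obtain ⟨y, hy, rfl⟩ := Finset.mem_image.1 hx
      exact hpos y hy, Finset.le_max' _ _ hx⟩) hLmem
    (by
      rw [← hML]
      calc X' M ≤ d * X' M := Nat.le_mul_of_pos_left _ hdpos
        _ = M := (hX' M hM).symm
        _ ≤ m := (Finset.mem_Icc.1 (hX hM)).2)
    (fun e he => Nat.dvd_one.1 (hgcd ▸ Finset.dvd_gcd fun x hx =>
      he _ (Finset.mem_image_of_mem _ hx)))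
  refine ⟨d * a, d, hdpos, fun i hi him => ?_⟩
  obtain ⟨Y, hYX, hY1, hYc, hYs⟩ := ha i hi him
  refine ⟨Multiset.card Y, hY1, ?_, Y.map (d * ·), ?_, Multiset.card_map _ _, ?_⟩
  · have hn0 : 0 < n := hn ▸ hXne.card_pos
    rw [le_div_iff₀ (by exact_mod_cast hn0)]
    rw [hcard] at hYc
    exact_mod_cast hYc.trans (by omega)
  · intro y hy
    obtain ⟨z, hz, rfl⟩ := Multiset.mem_map.1 hy
    obtain ⟨x, hx, rfl⟩ := Finset.mem_image.1 (hYX z hz)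
    rwa [← hX' x hx]
  · rw [Multiset.sum_map_mul_left, Multiset.map_id', hYs]
    ring
end
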